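/- arXiv:2512.05154 — 4 statements merged into one kernel-verified Lean document; each statement's English description precedes it below -/
import Mathlib

section
/- Fix c ∈ {6, 7} and ε > 0. There exists a constant C > 0 such that for all positive integers q and all integers n, |A_{n,c}(q)| ≤ C · q^{9/2 + ε}; the constant C is uniform in n. -/
open MeasureTheory Finset

noncomputable section

/-- `e(x) = exp(2πix)`. -/
def e (x : ℝ) : ℂ := Complex.exp (2 * Real.pi * Complex.I * x)

/-- `P_k = n^(1/k)`. -/
def P (n k : ℕ) : ℝ := (n : ℝ) ^ ((k : ℝ))⁻¹

/-- `θ_6 = 5/6`, `θ_7 = 87/98`. -/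
def θ (c : ℕ) : ℝ := if c = 6 then 5 / 6 else 87 / 98

/-- `Θ_c = 2/3 + θ_c/5 + 1/6 + 1/c`. -/
def Θ (c : ℕ) : ℝ := 2 / 3 + θ c / 5 + 1 / 6 + ((c : ℝ))⁻¹

/-- `f_k(α) = Σ_{P_k/2 < p ≤ P_k, p prime} e(α p^k) log p`. -/
def f (n k : ℕ) (α : ℝ) : ℂ :=
  ∑ p ∈ (Finset.range (n + 1)).filter
      (fun p : ℕ => p.Prime ∧ P n k / 2 < (p : ℝ) ∧ (p : ℝ) ≤ P n k),
    e (α * (p : ℝ) ^ k) * (Real.log p)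

/-- `f_{5,c}(α) = Σ_{1 < p ≤ P_5^{θ_c}, p prime} e(α p^5) log p`. -/
def f5 (n c : ℕ) (α : ℝ) : ℂ :=
  ∑ p ∈ (Finset.range (n + 1)).filter
      (fun p : ℕ => p.Prime ∧ 1 < (p : ℝ) ∧ (p : ℝ) ≤ P n 5 ^ θ c),
    e (α * (p : ℝ) ^ 5) * (Real.log p)

/-- `F_c(α) = f_2(α)^2 f_3(α)^2 f_{5,c}(α) f_6(α) f_c(α)`. -/
def F (n c : ℕ) (α : ℝ) : ℂ :=
  f n 2 α ^ 2 * f n 3 α ^ 2 * f5 n c α * f n 6 α * f n c α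

/-- `S_k(q,a) = Σ_{x=1,(x,q)=1}^{q} e(a x^k / q)`. -/
def S (k q a : ℕ) : ℂ :=
  ∑ x ∈ (Finset.Icc 1 q).filter (fun x => Nat.gcd x q = 1),
    e ((a : ℝ) * (x : ℝ) ^ k / q)

/-- `v_k(β) = (1/k) Σ_{2^{-k} n < m ≤ n} m^{1/k-1} e(β m)`. -/
def v (n k : ℕ) (β : ℝ) : ℂ :=
  ((k : ℂ))⁻¹ *
    ∑ m ∈ (Finset.Icc 1 n).filter (fun m : ℕ => (n : ℝ) / 2 ^ k < (m : ℝ)),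
      ((m : ℝ) ^ ((k : ℝ)⁻¹ - 1) : ℝ) * e (β * m)

/-- `w_c(β) = v_2(β)^2 v_3(β)^2 v_6(β) v_c(β)`. -/
def w (n c : ℕ) (β : ℝ) : ℂ := v n 2 β ^ 2 * v n 3 β ^ 2 * v n 6 β * v n c β

/-- `U_c(q,a) = S_2(q,a)^2 S_3(q,a)^2 S_5(q,a) S_6(q,a) S_c(q,a)`. -/
def U (c q a : ℕ) : ℂ := S 2 q a ^ 2 * S 3 q a ^ 2 * S 5 q a * S 6 q a * S c q a

/-- `A_{n,c}(q) = Σ_{a=1,(a,q)=1}^{q} U_c(q,a) e(-a n / q)`. -/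
def A (n : ℤ) (c q : ℕ) : ℂ :=
  ∑ a ∈ (Finset.Icc 1 q).filter (fun a => Nat.gcd a q = 1),
    U c q a * e (-((a : ℝ) * (n : ℝ)) / q)

/-- The major arcs `𝔐`. -/
def Maj (n : ℕ) (B : ℝ) : Set ℝ :=
  {α | α ∈ Set.Icc (0 : ℝ) 1 ∧ ∃ a q : ℕ, a ≤ q ∧ 1 ≤ q ∧
    (q : ℝ) ≤ Real.log n ^ B ∧ Nat.gcd a q = 1 ∧
    |α - (a : ℝ) / q| ≤ Real.log n ^ B / n}

/-- `Q_c = n^{2/(3c²(c-1))}`. -/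
def Q (n c : ℕ) : ℝ := (n : ℝ) ^ (2 / (3 * (c : ℝ) ^ 2 * ((c : ℝ) - 1)))

/-- The arcs `𝕽_c`. -/
def R (n c : ℕ) : Set ℝ :=
  {α | α ∈ Set.Icc (0 : ℝ) 1 ∧ ∃ a q : ℕ, a ≤ q ∧ 1 ≤ q ∧
    (q : ℝ) ≤ Q n c ∧ Nat.gcd a q = 1 ∧ |(q : ℝ) * α - a| ≤ Q n c / n}

/-- `τ = 2^{-20}`. -/
def τ : ℝ := ((2 : ℝ) ^ (20 : ℕ))⁻¹

/-- The sets `𝓔_c`. -/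
def E (n c : ℕ) : Set ℝ :=
  {α | α ∈ Set.Icc (0 : ℝ) 1 ∧
    ‖f n c α‖ ≤ P n c ^ (if c = 6 then 1 - 24 * τ else 139 / 140 - 24 * τ)}

end


lemma tors_cyclic (G : Type*) [CommGroup G] [Finite G] [IsCyclic G] (k : ℕ) (hk : 0 < k) :
    Nat.card {x : G // x ^ k = 1} ≤ k := by
  classical
  have := Fintype.ofFinite G
  have h := IsCyclic.card_pow_eq_one_le (α := G) hk
  rw [Nat.card_eq_fintype_card, Fintype.card_subtype]
  convert h

lemma tors_index (G : Type*) [CommGroup G] [Finite G] (H : Subgroup G) [IsCyclic H]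
    (k : ℕ) (hk : 0 < k) :
    Nat.card {x : G // x ^ k = 1} ≤ H.index * k := by
  let T : Subgroup G := (powMonoidHom k : G →* G).ker
  have h1 : Nat.card {x : G // x ^ k = 1} = Nat.card T := rfl
  have h2 := Subgroup.card_mul_index (H.subgroupOf T)
  have h3 : (H.subgroupOf T).index ≤ H.index :=
    Nat.le_of_dvd (Nat.pos_of_ne_zero H.index_ne_zero_of_finite)
      (Subgroup.relIndex_dvd_index_of_normal H T)
  have h4 : Nat.card (H.subgroupOf T) ≤ Nat.card {x : H // x ^ k = 1} := by
    apply Nat.card_le_card_of_injective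
      (fun x : H.subgroupOf T => (⟨⟨x.1.1, x.2⟩, by
        have := x.1.2
        rw [Subtype.ext_iff]
        exact this⟩ : {x : H // x ^ k = 1}))
    intro x y hxy
    exact Subtype.ext (Subtype.ext (congrArg (fun z : {x : H // x ^ k = 1} => (z.1.1 : G)) hxy))
  have h5 := tors_cyclic H k hk
  rw [h1, ← h2, mul_comm]
  exact Nat.mul_le_mul h3 (h4.trans h5)

lemma tors_prime_pow (p n : ℕ) (hp : p.Prime) (k : ℕ) (hk : 0 < k) :
    Nat.card {x : (ZMod (p ^ n))ˣ // x ^ k = 1} ≤ 2 * k := by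
  have : NeZero (p ^ n) := ⟨pow_ne_zero _ hp.ne_zero⟩
  by_cases h2 : p = 2
  · subst h2
    rcases le_or_gt n 2 with hn | hn
    · have := (ZMod.isCyclic_units_two_pow_iff n).2 hn
      have := tors_cyclic (ZMod (2 ^ n))ˣ k hk
      omega
    · obtain ⟨m, rfl⟩ : ∃ m, n = m + 2 := ⟨n - 2, by omega⟩
      have h5 : IsUnit (5 : ZMod (2 ^ (m + 2))) := by
        have : ((5 : ℕ) : ZMod (2 ^ (m + 2))) = 5 := by norm_num
        rw [← this, ZMod.isUnit_iff_coprime]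
        exact Nat.Coprime.pow_right _ (by norm_num)
      obtain ⟨u, hu⟩ := h5
      have ho : orderOf u = 2 ^ m := by
        rw [← orderOf_units, hu, ZMod.orderOf_five]
      have hc := Subgroup.card_mul_index (Subgroup.zpowers u)
      rw [Nat.card_zpowers, ho, Nat.card_eq_fintype_card, ZMod.card_units_eq_totient,
        Nat.totient_prime_pow_succ Nat.prime_two] at hc
      have hi : (Subgroup.zpowers u).index = 2 := by
        have : 0 < 2 ^ m := by positivity
        refine Nat.eq_of_mul_eq_mul_left this ?_
        rw [hc, show m + 1 = m + 1 from rfl]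
        ring
      have := tors_index _ (Subgroup.zpowers u) k hk
      rwa [hi] at this
  · have := ZMod.isCyclic_units_of_prime_pow p hp h2 n
    have := tors_cyclic (ZMod (p ^ n))ˣ k hk
    omega

lemma tors_bound (k : ℕ) (hk : 0 < k) (q : ℕ) (hq : q ≠ 0) :
    Nat.card {x : (ZMod q)ˣ // x ^ k = 1} ≤ (2 * k) ^ q.primeFactors.card := by
  induction q using Nat.recOnPosPrimePosCoprime with
  | zero => exact absurd rfl hq
  | one =>
    rw [Nat.primeFactors_one, Finset.card_empty, pow_zero]
    exact Finite.card_le_one_iff_subsingleton.2 inferInstance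
  | prime_pow p n hp hn =>
    rw [Nat.primeFactors_prime_pow hn.ne' hp]
    simpa using tors_prime_pow p n hp k hk
  | coprime a b ha hb hab iha ihb =>
    have : NeZero a := ⟨by omega⟩
    have : NeZero b := ⟨by omega⟩
    rw [hab.primeFactors_mul, Finset.card_union_of_disjoint hab.disjoint_primeFactors, pow_add]
    refine le_trans ?_ (Nat.mul_le_mul (iha (by omega)) (ihb (by omega)))
    rw [← Nat.card_prod]
    let φ : (ZMod (a * b))ˣ ≃* (ZMod a)ˣ × (ZMod b)ˣ :=
      (Units.mapEquiv (ZMod.chineseRemainder hab).toMulEquiv).trans .prodUnits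
    apply Nat.card_le_card_of_injective
      (fun x : {x : (ZMod (a * b))ˣ // x ^ k = 1} =>
        ((⟨(φ x.1).1, by rw [← Prod.pow_fst, ← map_pow, x.2]; simp⟩,
          ⟨(φ x.1).2, by rw [← Prod.pow_snd, ← map_pow, x.2]; simp⟩) :
          {x : (ZMod a)ˣ // x ^ k = 1} × {x : (ZMod b)ˣ // x ^ k = 1}))
    intro x y hxy
    simp only [Prod.mk.injEq, Subtype.mk.injEq] at hxy
    exact Subtype.ext (φ.injective (Prod.ext hxy.1 hxy.2))

lemma omega_bound (K : ℝ) (hK : 1 ≤ K) (ε : ℝ) (hε : 0 < ε) :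
    ∃ C : ℝ, 0 < C ∧ ∀ q : ℕ, 0 < q → K ^ q.primeFactors.card ≤ C * (q : ℝ) ^ ε := by
  obtain ⟨M, hM⟩ := exists_nat_gt (K ^ (ε⁻¹))
  refine ⟨K ^ M, by positivity, fun q hq => ?_⟩
  have hp : ∀ p : ℕ, M ≤ p → K ≤ (p : ℝ) ^ ε := by
    intro p hp
    have h0 : K ^ (ε⁻¹) ≤ (p : ℝ) := hM.le.trans (by exact_mod_cast hp)
    calc K = (K ^ (ε⁻¹)) ^ ε := by
          rw [← Real.rpow_mul (by linarith), inv_mul_cancel₀ hε.ne', Real.rpow_one]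
      _ ≤ _ := Real.rpow_le_rpow (by positivity) h0 hε.le
  rw [← Finset.card_filter_add_card_filter_not (fun p => p < M), pow_add]
  refine mul_le_mul (pow_le_pow_right₀ hK ?_) ?_ (by positivity) (by positivity)
  · calc _ ≤ (Finset.range M).card := Finset.card_le_card (by
          intro p; simp only [Finset.mem_filter, Finset.mem_range]; tauto)
      _ = M := by simp
  · calc K ^ (Finset.card {p ∈ q.primeFactors | ¬ p < M})
        = ∏ p ∈ q.primeFactors with ¬ p < M, K := by simp
      _ ≤ ∏ p ∈ q.primeFactors with ¬ p < M, (p : ℝ) ^ ε := by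
          apply Finset.prod_le_prod
          · intros; linarith
          · intro p h
            exact hp p (by simp only [Finset.mem_filter] at h; omega)
      _ ≤ ∏ p ∈ q.primeFactors, (p : ℝ) ^ ε := by
          rw [← Finset.prod_filter_mul_prod_filter_not q.primeFactors (fun p => p < M)
            (fun p => (p : ℝ) ^ ε)]
          refine le_mul_of_one_le_left (by positivity) ?_
          have h1 : ∏ p ∈ q.primeFactors with p < M, (1 : ℝ) ≤
              ∏ p ∈ q.primeFactors with p < M, (p : ℝ) ^ ε := by
            apply Finset.prod_le_prod
            · intros; norm_num
            · intro p h
              have := (Nat.prime_of_mem_primeFactors (Finset.mem_filter.1 h).1).one_le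
              exact Real.one_le_rpow (by exact_mod_cast this) hε.le
          simpa using h1
      _ = (∏ p ∈ q.primeFactors, (p : ℝ)) ^ ε := by
          rw [Real.finsetProd_rpow]; intros; positivity
      _ ≤ _ := by
          apply Real.rpow_le_rpow (by positivity) _ hε.le
          rw [← Nat.cast_prod]
          exact Nat.cast_le.2 (Nat.le_of_dvd hq (Nat.prod_primeFactors_dvd q))

/-- the sum over units -/
noncomputable def TT (q : ℕ) [NeZero q] (k : ℕ) (b : ZMod q) : ℂ :=
  ∑ x : (ZMod q)ˣ, ZMod.stdAddChar (b * ((x ^ k : (ZMod q)ˣ) : ZMod q))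

lemma fiber_card (G : Type*) [CommGroup G] [Fintype G] [DecidableEq G] (k : ℕ) (y : G) :
    (Finset.univ.filter (fun u : G => u ^ k = y)).card ≤ Nat.card {x : G // x ^ k = 1} := by
  rw [Nat.card_eq_fintype_card, Fintype.card_subtype]
  rcases (Finset.univ.filter (fun u : G => u ^ k = y)).eq_empty_or_nonempty with h | ⟨u, hu⟩
  · simp [h]
  · simp only [Finset.mem_filter, Finset.mem_univ, true_and] at hu
    apply Finset.card_le_card_of_injOn (fun x => x / u)
    · intro x hx
      simp only [Finset.coe_filter, Finset.mem_univ, true_and, Set.mem_ofPred_eq] at hx ⊢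
      rw [div_pow, hx, hu, div_self']
    · intro x _ y _ h
      exact div_left_injective h

lemma TT_parseval (q : ℕ) [NeZero q] (k : ℕ) :
    ∑ b : ZMod q, ‖TT q k b‖ ^ 2 ≤
      q * (Fintype.card (ZMod q)ˣ * Nat.card {x : (ZMod q)ˣ // x ^ k = 1}) := by
  have key : ((∑ b : ZMod q, ‖TT q k b‖ ^ 2 : ℝ) : ℂ) =
      ((q * ∑ x : (ZMod q)ˣ, (Finset.univ.filter (fun y : (ZMod q)ˣ => y ^ k = x ^ k)).card : ℝ) : ℂ) := by
    push_cast
    calc ∑ b : ZMod q, (‖TT q k b‖ : ℂ) ^ 2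
        = ∑ b : ZMod q, ∑ x : (ZMod q)ˣ, ∑ y : (ZMod q)ˣ,
            ZMod.stdAddChar (b * (((x ^ k : (ZMod q)ˣ) : ZMod q) - ((y ^ k : (ZMod q)ˣ) : ZMod q))) := by
          apply Finset.sum_congr rfl
          intro b _
          rw [← Complex.mul_conj', TT, map_sum, Finset.sum_mul_sum]
          refine Finset.sum_congr rfl fun x _ => Finset.sum_congr rfl fun y _ => ?_
          rw [← AddChar.map_neg_eq_conj, ← AddChar.map_add_eq_mul]
          congr 1; ring
      _ = ∑ x : (ZMod q)ˣ, ∑ y : (ZMod q)ˣ, ∑ b : ZMod q,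
            ZMod.stdAddChar (b * (((x ^ k : (ZMod q)ˣ) : ZMod q) - ((y ^ k : (ZMod q)ˣ) : ZMod q))) := by
          rw [Finset.sum_comm]
          refine Finset.sum_congr rfl fun x _ => ?_
          rw [Finset.sum_comm]
      _ = _ := by
          rw [Finset.mul_sum]
          refine Finset.sum_congr rfl fun x _ => ?_
          rw [Finset.card_filter]
          push_cast
          rw [Finset.mul_sum]
          refine Finset.sum_congr rfl fun y _ => ?_
          rw [AddChar.sum_mulShift _ (ZMod.isPrimitive_stdAddChar q)]
          simp only [sub_eq_zero, Units.val_inj, ZMod.card, ← Units.val_pow_eq_pow_val]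
          by_cases h : x ^ k = y ^ k
          · simp [h]
          · simp [h, Ne.symm h]
  rw [Complex.ofReal_inj] at key
  rw [key]
  gcongr
  calc _ ≤ ∑ x : (ZMod q)ˣ, (Nat.card {x : (ZMod q)ˣ // x ^ k = 1} : ℝ) := by
        push_cast
        apply Finset.sum_le_sum
        intro x _
        exact_mod_cast fiber_card _ k (x ^ k)
    _ = _ := by simp

lemma TT_bound (q : ℕ) [NeZero q] (k : ℕ) (a : (ZMod q)ˣ) :
    ‖TT q k a‖ ≤ Real.sqrt q * Nat.card {x : (ZMod q)ˣ // x ^ k = 1} := by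
  set N := Nat.card {x : (ZMod q)ˣ // x ^ k = 1} with hN
  have hinv : ∀ u : (ZMod q)ˣ, TT q k ((a * u ^ k : (ZMod q)ˣ) : ZMod q) = TT q k a := by
    intro u
    unfold TT
    apply Fintype.sum_equiv (Equiv.mulLeft u)
    intro x
    congr 1
    simp only [Equiv.coe_mulLeft, mul_pow, Units.val_mul]
    ring
  have h1 : (Fintype.card (ZMod q)ˣ : ℝ) * ‖TT q k a‖ ^ 2 ≤ N * ∑ b : ZMod q, ‖TT q k b‖ ^ 2 := by
    calc _ = ∑ u : (ZMod q)ˣ, ‖TT q k ((a * u ^ k : (ZMod q)ˣ) : ZMod q)‖ ^ 2 := by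
          simp only [hinv, Finset.sum_const, nsmul_eq_mul, Finset.card_univ]
      _ = ∑ b : (ZMod q)ˣ, ∑ u : (ZMod q)ˣ with a * u ^ k = b,
            ‖TT q k ((a * u ^ k : (ZMod q)ˣ) : ZMod q)‖ ^ 2 := by
          rw [Finset.sum_fiberwise_of_maps_to]; simp
      _ ≤ ∑ b : (ZMod q)ˣ, N * ‖TT q k (b : ZMod q)‖ ^ 2 := by
          apply Finset.sum_le_sum
          intro b _
          rw [Finset.sum_congr rfl (g := fun _ => ‖TT q k (b : ZMod q)‖ ^ 2)]
          · rw [Finset.sum_const, nsmul_eq_mul]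
            gcongr
            refine le_trans (le_of_eq ?_) (fiber_card _ k (a⁻¹ * b))
            congr 1
            ext u
            simp [eq_inv_mul_iff_mul_eq]
          · intro u hu
            simp only [Finset.mem_filter] at hu
            rw [hu.2]
      _ = N * ∑ b : (ZMod q)ˣ, ‖TT q k (b : ZMod q)‖ ^ 2 := by rw [Finset.mul_sum]
      _ ≤ _ := by
          gcongr
          have hm := Finset.sum_map Finset.univ ⟨fun u : (ZMod q)ˣ => (u : ZMod q), Units.val_injective⟩
            (fun b => ‖TT q k b‖ ^ 2)
          refine hm.symm.trans_le ?_
          exact Finset.sum_le_sum_of_subset_of_nonneg (Finset.subset_univ _) (by intros; positivity)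
  have h2 := TT_parseval q k
  have hφ : (0 : ℝ) < Fintype.card (ZMod q)ˣ := by exact_mod_cast Fintype.card_pos
  have h3 : ‖TT q k a‖ ^ 2 ≤ (Real.sqrt q * N) ^ 2 := by
    rw [mul_pow, Real.sq_sqrt (by positivity)]
    refine le_of_mul_le_mul_left ?_ hφ
    calc _ ≤ _ := h1
      _ ≤ N * (q * (Fintype.card (ZMod q)ˣ * N)) := by gcongr
      _ = _ := by ring
  exact le_of_sq_le_sq h3 (by positivity)

lemma S_eq_TT (q : ℕ) [NeZero q] (k a : ℕ) : S k q a = TT q k (a : ZMod q) := by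
  unfold S TT
  have hq : 0 < q := Nat.pos_of_ne_zero (NeZero.ne q)
  refine Finset.sum_bij
    (fun x hx => ZMod.unitOfCoprime x (Finset.mem_filter.1 hx).2) ?_ ?_ ?_ ?_
  · intros; exact Finset.mem_univ _
  · intro x hx y hy h
    have h' := congrArg (fun u : (ZMod q)ˣ => (u : ZMod q)) h
    simp only [ZMod.coe_unitOfCoprime] at h'
    rw [ZMod.natCast_eq_natCast_iff] at h'
    simp only [Finset.mem_filter, Finset.mem_Icc] at hx hy
    have h2 : (x : ℤ) ≡ y [ZMOD q] := by exact_mod_cast (Int.natCast_modEq_iff.2 h')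
    have h3 := h2.dvd
    have h4 : (y : ℤ) - x = 0 := Int.eq_zero_of_abs_lt_dvd h3 (by rw [abs_lt]; constructor <;> omega)
    omega
  · intro u _
    have hc : Nat.Coprime (u : ZMod q).val q := ZMod.val_coe_unit_coprime u
    by_cases h0 : (u : ZMod q).val = 0
    · rw [h0, Nat.coprime_zero_left] at hc
      subst hc
      exact ⟨1, by simp, Subsingleton.elim _ _⟩
    · refine ⟨(u : ZMod q).val, ?_, ?_⟩
      · simp only [Finset.mem_filter, Finset.mem_Icc]
        exact ⟨⟨by omega, (ZMod.val_lt _).le⟩, hc⟩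
      · ext; simp
  · intro x hx
    have h := ZMod.stdAddChar_coe (N := q) ((a * x ^ k : ℕ) : ℤ)
    simp only [Units.val_pow_eq_pow_val, ZMod.coe_unitOfCoprime]
    push_cast at h
    rw [h]
    unfold e
    congr 1
    push_cast
    ring

lemma norm_e (x : ℝ) : ‖e x‖ = 1 := by
  unfold e
  have : (2 * Real.pi * Complex.I * x : ℂ) = ((2 * Real.pi * x : ℝ) : ℂ) * Complex.I := by
    push_cast; ring
  rw [this, Complex.norm_exp_ofReal_mul_I]

lemma S_bound (k : ℕ) (hk : 0 < k) (ε : ℝ) (hε : 0 < ε) :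
    ∃ C : ℝ, 0 < C ∧ ∀ q : ℕ, 0 < q → ∀ a : ℕ, Nat.gcd a q = 1 →
      ‖S k q a‖ ≤ C * (q : ℝ) ^ ((1 : ℝ) / 2 + ε) := by
  obtain ⟨C, hC, h⟩ := omega_bound (2 * k) (by
    have : (1 : ℝ) ≤ k := by exact_mod_cast hk
    linarith) ε hε
  refine ⟨C, hC, fun q hq a ha => ?_⟩
  have : NeZero q := ⟨hq.ne'⟩
  have hq' : (0 : ℝ) < q := by exact_mod_cast hq
  have h1 := TT_bound q k (ZMod.unitOfCoprime a ha)
  rw [ZMod.coe_unitOfCoprime, ← S_eq_TT] at h1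
  have h2 : (Nat.card {x : (ZMod q)ˣ // x ^ k = 1} : ℝ) ≤ (2 * k) ^ q.primeFactors.card := by
    exact_mod_cast tors_bound k hk q hq.ne'
  calc _ ≤ _ := h1
    _ ≤ Real.sqrt q * (C * (q : ℝ) ^ ε) := by
        gcongr
        exact h2.trans (h q hq)
    _ = _ := by
        rw [Real.rpow_add hq', Real.sqrt_eq_rpow]
        ring

/-- `A_{n,c}(q) ≪ q^{9/2+ε}` uniformly in `n`. -/
theorem A_bound (c : ℕ) (hc : c = 6 ∨ c = 7) (ε : ℝ) (hε : 0 < ε) :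
    ∃ C : ℝ, 0 < C ∧ ∀ q : ℕ, 0 < q → ∀ n : ℤ,
      ‖A n c q‖ ≤ C * (q : ℝ) ^ ((9 : ℝ) / 2 + ε) := by
  obtain ⟨C2, hC2, h2⟩ := S_bound 2 (by norm_num) (ε / 7) (by positivity)
  obtain ⟨C3, hC3, h3⟩ := S_bound 3 (by norm_num) (ε / 7) (by positivity)
  obtain ⟨C5, hC5, h5⟩ := S_bound 5 (by norm_num) (ε / 7) (by positivity)
  obtain ⟨C6, hC6, h6⟩ := S_bound 6 (by norm_num) (ε / 7) (by positivity)
  obtain ⟨Cc, hCc, hc'⟩ := S_bound c (by omega) (ε / 7) (by positivity)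
  refine ⟨C2 ^ 2 * C3 ^ 2 * C5 * C6 * Cc, by positivity, fun q hq n => ?_⟩
  have hq' : (0 : ℝ) < q := by exact_mod_cast hq
  set X : ℝ := (q : ℝ) ^ ((1 : ℝ) / 2 + ε / 7) with hX
  have hX0 : 0 < X := by positivity
  have hX7 : (q : ℝ) ^ ((9 : ℝ) / 2 + ε) = q * X ^ 7 := by
    rw [hX, ← Real.rpow_natCast, ← Real.rpow_mul hq'.le]
    nth_rewrite 2 [← Real.rpow_one (q : ℝ)]
    rw [← Real.rpow_add hq']
    congr 1
    push_cast
    ring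
  rw [hX7]
  unfold A
  calc _ ≤ ∑ a ∈ (Finset.Icc 1 q).filter (fun a => Nat.gcd a q = 1),
        ‖U c q a * e (-((a : ℝ) * (n : ℝ)) / q)‖ := norm_sum_le _ _
    _ ≤ ∑ a ∈ (Finset.Icc 1 q).filter (fun a => Nat.gcd a q = 1),
        (C2 * X) ^ 2 * (C3 * X) ^ 2 * (C5 * X) * (C6 * X) * (Cc * X) := by
        apply Finset.sum_le_sum
        intro a ha
        have ha' := (Finset.mem_filter.1 ha).2
        rw [norm_mul, norm_e, mul_one]
        unfold U
        simp only [norm_mul, norm_pow]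
        gcongr
        · exact h2 q hq a ha'
        · exact h3 q hq a ha'
        · exact h5 q hq a ha'
        · exact h6 q hq a ha'
        · exact hc' q hq a ha'
    _ ≤ q * ((C2 * X) ^ 2 * (C3 * X) ^ 2 * (C5 * X) * (C6 * X) * (Cc * X)) := by
        rw [Finset.sum_const, nsmul_eq_mul]
        gcongr
        refine (Finset.card_filter_le _ _).trans ?_
        simp
    _ = _ := by ring
end

section
/- Fix c ∈ {6, 7}. For every integer n the series 𝔖_c(n) = Σ_{q=1}^{∞} A_{n,c}(q) / φ(q)^7 converges absolutely, and there exist a constant κ > 0 and N such that for every odd integer n ≥ N one has 𝔖_c(n) ≥ κ (in particular the real part of 𝔖_c(n) is ≥ κ). -/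
open MeasureTheory Finset

namespace SS
variable {R : Type} [CommRing R] [Fintype Rˣ]

noncomputable def G (ψ : AddChar R ℂ) (k : ℕ) (a : R) : ℂ := ∑ x : Rˣ, ψ (a * (x:R)^k)
def kk (c : ℕ) : Fin 7 → ℕ := ![2,2,3,3,5,6,c]
noncomputable def T (ψ : AddChar R ℂ) (c : ℕ) (n : ℤ) : ℂ :=
  ∑ a : Rˣ, (∏ i, G ψ (kk c i) a) * ψ (-((a:R)*n))

lemma T_shift (ψ : AddChar R ℂ) (c : ℕ) (n : ℤ) (u : Rˣ) :
    T (ψ.mulShift (u:R)) c n = T ψ c n := by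
  unfold T
  refine Fintype.sum_equiv (Equiv.mulLeft u) _ _ ?_
  intro a
  simp only [G, AddChar.mulShift_apply, Equiv.coe_mulLeft, Units.val_mul]
  congr 1
  · simp only [mul_assoc]
  · congr 1; ring

lemma T_mul {R R1 R2 : Type} [CommRing R] [CommRing R1] [CommRing R2]
    [Fintype Rˣ] [Fintype R1ˣ] [Fintype R2ˣ] (f : R ≃+* R1 × R2)
    (ψ : AddChar R ℂ) (ψ1 : AddChar R1 ℂ) (ψ2 : AddChar R2 ℂ)
    (h : ∀ z, ψ z = ψ1 (f z).1 * ψ2 (f z).2) (c : ℕ) (n : ℤ) :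
    T ψ c n = T ψ1 c n * T ψ2 c n := by
  let g : Rˣ ≃ R1ˣ × R2ˣ := ((Units.mapEquiv f.toMulEquiv).trans MulEquiv.prodUnits).toEquiv
  have g1 : ∀ x : Rˣ, ((g x).1 : R1) = (f x).1 := fun x => rfl
  have g2 : ∀ x : Rˣ, ((g x).2 : R2) = (f x).2 := fun x => rfl
  have hG : ∀ k (a : R), G ψ k a = G ψ1 k (f a).1 * G ψ2 k (f a).2 := by
    intro k a
    unfold G
    rw [Finset.sum_mul_sum, ← Fintype.sum_prod_type']
    refine Fintype.sum_equiv g _ _ ?_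
    intro x
    rw [h, g1, g2]; simp
  unfold T
  rw [Finset.sum_mul_sum, ← Fintype.sum_prod_type']
  refine Fintype.sum_equiv g _ _ ?_
  intro a
  rw [h, g1, g2]
  simp only [hG, Finset.prod_mul_distrib]
  simp
  ring

lemma G_zero [Fintype R] (ψ : AddChar R ℂ) (hψ : ψ.IsPrimitive) (k : ℕ) (hk : IsUnit (k : R)) (ε : R)
    (h0 : ε ≠ 0) (h2 : ε * ε = 0) (a : Rˣ) : G ψ k a = 0 := by
  have key : ∀ s : R, G ψ k a = ∑ x : Rˣ, ψ (a * (x:R)^k) * ψ (s * (a * (x:R)^k * k * ε)) := by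
    intro s
    let u : Rˣ := ⟨1 + ε * s, 1 - ε * s, by linear_combination (-s^2) * h2,
      by linear_combination (-s^2) * h2⟩
    unfold G
    rw [← Equiv.sum_comp (Equiv.mulLeft u)]
    refine Finset.sum_congr rfl fun x _ => ?_
    rw [← AddChar.map_add_eq_mul]
    congr 1
    have : ∀ k : ℕ, (1 + ε * s)^k = 1 + k * (ε * s) := by
      intro k
      induction k with
      | zero => simp
      | succ k ih => rw [pow_succ, ih]; push_cast; linear_combination (k * s^2) * h2
    simp only [Equiv.coe_mulLeft, Units.val_mul, mul_pow]
    rw [show (u : R) = 1 + ε * s from rfl, this]; ring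
  have h3 : (Fintype.card R : ℂ) * G ψ k a = 0 := by
    calc (Fintype.card R : ℂ) * G ψ k a = ∑ s : R, G ψ k a := by simp
      _ = ∑ s : R, ∑ x : Rˣ, ψ (a * (x:R)^k) * ψ (s * (a * (x:R)^k * k * ε)) :=
          Finset.sum_congr rfl fun s _ => key s
      _ = 0 := by
        classical
        rw [Finset.sum_comm]
        refine Finset.sum_eq_zero fun x _ => ?_
        rw [← Finset.mul_sum, AddChar.sum_mulShift _ hψ, if_neg, Nat.cast_zero, mul_zero]
        have : IsUnit ((a:R) * (x:R)^k * k) := (a.isUnit.mul (x.isUnit.pow k)).mul hk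
        rw [this.mul_right_eq_zero]; exact h0
  rcases mul_eq_zero.1 h3 with h | h
  · simp at h
  · exact h

-- prime field case
variable {K : Type} [Field K] [Fintype K] [DecidableEq K]

lemma fiber (k : ℕ) (hk : 0 < k) (b : Kˣ) : #{x : Kˣ | x ^ k = b} ≤ k := by
  have : #{x : Kˣ | x ^ k = b} ≤ (Polynomial.nthRoots k (b:K)).toFinset.card := by
    refine Finset.card_le_card_of_injOn (fun x => (x:K)) ?_ (fun x _ y _ h => Units.ext h)
    intro x hx
    simp only [Finset.coe_filter, Finset.mem_univ, true_and, Set.mem_ofPred_eq] at hx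
    simp [Polynomial.mem_nthRoots hk, ← hx]
  exact this.trans ((Multiset.toFinset_card_le _).trans (Polynomial.card_nthRoots k _))

lemma sum_pow_le (k : ℕ) (hk : 0 < k) (g : Kˣ → ℝ) (hg : ∀ x, 0 ≤ g x) :
    ∑ y : Kˣ, g (y ^ k) ≤ k * ∑ b : Kˣ, g b := by
  rw [← Finset.sum_fiberwise (s := univ) (g := fun y : Kˣ => y ^ k), Finset.mul_sum]
  refine Finset.sum_le_sum fun b _ => ?_
  rw [Finset.sum_congr rfl (g := fun _ => g b) (by intro x hx; simp at hx; rw [hx])]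
  rw [Finset.sum_const, nsmul_eq_mul]
  exact mul_le_mul_of_nonneg_right (by exact_mod_cast fiber k hk b) (hg b)

lemma G_bound (ψ : AddChar K ℂ) (hψ : ψ.IsPrimitive) (k : ℕ) (hk : 0 < k) (a : Kˣ) :
    ‖G ψ k a‖ ^ 2 ≤ k ^ 2 * Fintype.card K := by
  have inv : ∀ y : Kˣ, G ψ k ((a * y ^ k : Kˣ) : K) = G ψ k a := by
    intro y
    unfold G
    refine Fintype.sum_equiv (Equiv.mulLeft y) _ _ fun x => ?_
    simp [mul_pow, mul_assoc]
  have second : ∑ b : K, ‖G ψ k b‖ ^ 2 ≤ Fintype.card K * (k * Fintype.card Kˣ) := by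
    have e1 : ((∑ b : K, ‖G ψ k b‖ ^ 2 : ℝ) : ℂ)
        = ((Fintype.card K * ∑ x : Kˣ, (#{y : Kˣ | y ^ k = x ^ k} : ℝ) : ℝ) : ℂ) := by
      push_cast
      have : ∀ b : K, ((‖G ψ k b‖ : ℂ)) ^ 2
          = ∑ x : Kˣ, ∑ y : Kˣ, ψ (b * ((x:K)^k - (y:K)^k)) := by
        intro b
        rw [← Complex.mul_conj']
        unfold G
        rw [map_sum, Finset.sum_mul_sum]
        refine Finset.sum_congr rfl fun x _ => Finset.sum_congr rfl fun y _ => ?_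
        rw [← AddChar.map_neg_eq_conj, ← AddChar.map_add_eq_mul]
        congr 1; ring
      rw [Finset.sum_congr rfl fun b _ => this b, Finset.sum_comm, Finset.mul_sum]
      refine Finset.sum_congr rfl fun x _ => ?_
      rw [Finset.sum_comm, Finset.card_filter]
      push_cast
      rw [Finset.mul_sum]
      refine Finset.sum_congr rfl fun y _ => ?_
      rw [AddChar.sum_mulShift _ hψ]
      have : ((x:K)^k - (y:K)^k = 0) ↔ y ^ k = x ^ k := by
        rw [sub_eq_zero, eq_comm, ← Units.val_pow_eq_pow_val, ← Units.val_pow_eq_pow_val, Units.val_inj]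
      simp only [this]
      split_ifs <;> simp
    rw [Complex.ofReal_inj] at e1
    rw [e1]
    gcongr
    calc ∑ x : Kˣ, (#{y : Kˣ | y ^ k = x ^ k} : ℝ) ≤ ∑ x : Kˣ, (k:ℝ) :=
          Finset.sum_le_sum fun x _ => by exact_mod_cast fiber k hk _
      _ = k * Fintype.card Kˣ := by simp [mul_comm]
  have first : (Fintype.card Kˣ : ℝ) * ‖G ψ k a‖ ^ 2 ≤ k * ∑ b : K, ‖G ψ k b‖ ^ 2 := by
    calc (Fintype.card Kˣ : ℝ) * ‖G ψ k a‖ ^ 2 = ∑ y : Kˣ, ‖G ψ k ((a * y ^ k : Kˣ) : K)‖ ^ 2 := by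
          simp only [inv]; simp
      _ ≤ k * ∑ b : Kˣ, ‖G ψ k ((a * b : Kˣ) : K)‖ ^ 2 :=
          sum_pow_le k hk (fun b => ‖G ψ k ((a * b : Kˣ) : K)‖ ^ 2) (fun _ => by positivity)
      _ = k * ∑ b : Kˣ, ‖G ψ k (b : K)‖ ^ 2 := by
          congr 1
          exact Fintype.sum_equiv (Equiv.mulLeft a) _ _ fun x => rfl
      _ ≤ k * ∑ b : K, ‖G ψ k b‖ ^ 2 := by
          gcongr
          rw [← Finset.sum_image (s := univ) (g := fun b : Kˣ => (b:K)) (f := fun b => ‖G ψ k b‖ ^ 2)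
            (fun x _ y _ h => Units.ext h)]
          exact Finset.sum_le_sum_of_subset_of_nonneg (Finset.subset_univ _) fun _ _ _ => by positivity
  have hpos : (0:ℝ) < Fintype.card Kˣ := by exact_mod_cast Fintype.card_pos
  have hk' : (0:ℝ) < k := by exact_mod_cast hk
  refine le_of_mul_le_mul_left ?_ hpos
  calc _ ≤ _ := first
    _ ≤ k * (Fintype.card K * (k * Fintype.card Kˣ)) := by gcongr
    _ = _ := by ring

lemma G_triv (ψ : AddChar K ℂ) (k : ℕ) (a : K) : ‖G ψ k a‖ ≤ Fintype.card Kˣ := by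
  unfold G
  refine (norm_sum_le _ _).trans ?_
  simp

lemma map_sum_prod {ι : Type} (ψ : AddChar K ℂ) (s : Finset ι) (g : ι → K) :
    ψ (∑ i ∈ s, g i) = ∏ i ∈ s, ψ (g i) := by
  classical
  induction s using Finset.induction with
  | empty => simp
  | insert a s ha ih => rw [Finset.sum_insert ha, Finset.prod_insert ha, AddChar.map_add_eq_mul, ih]

/-- Counting solutions in a finite field. -/
lemma T_count (ψ : AddChar K ℂ) (hψ : ψ.IsPrimitive) (c : ℕ) (n : ℤ) :
    T ψ c n + (Fintype.card Kˣ : ℂ) ^ 7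
      = Fintype.card K * (#{x : Fin 7 → Kˣ | ∑ i, ((x i : K)) ^ (kk c i) = n} : ℂ) := by
  have hexp : ∀ a : K, (∏ i, G ψ (kk c i) a) * ψ (-(a * n))
      = ∑ x : Fin 7 → Kˣ, ψ (a * (∑ i, ((x i : K)) ^ (kk c i) - n)) := by
    intro a
    unfold G
    rw [Finset.prod_univ_sum, Finset.sum_mul]
    simp only [Fintype.piFinset_univ]
    refine Finset.sum_congr rfl fun x _ => ?_
    rw [← map_sum_prod, ← AddChar.map_add_eq_mul, ← Finset.mul_sum]
    congr 1; ring
  have hall : ∑ a : K, (∏ i, G ψ (kk c i) a) * ψ (-(a * n))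
      = Fintype.card K * (#{x : Fin 7 → Kˣ | ∑ i, ((x i : K)) ^ (kk c i) = n} : ℂ) := by
    rw [Finset.sum_congr rfl fun a _ => hexp a, Finset.sum_comm, Finset.card_filter]
    push_cast
    rw [Finset.mul_sum]
    refine Finset.sum_congr rfl fun x _ => ?_
    rw [AddChar.sum_mulShift _ hψ]
    simp only [sub_eq_zero]
    split_ifs <;> simp
  rw [← hall, ← Finset.add_sum_erase _ _ (Finset.mem_univ (0:K)), add_comm]
  congr 1
  · simp [G]
  · unfold T
    refine Finset.sum_bij (fun u _ => (u:K)) (by simp) (fun x _ y _ h => Units.ext h) ?_ (by simp)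
    intro b hb
    exact ⟨Units.mk0 b (by simpa using hb), by simp, rfl⟩

open ZMod in
lemma sum_units (q : ℕ) [NeZero q] (g : ZMod q → ℂ) :
    ∑ x ∈ (Finset.Icc 1 q).filter (fun x => Nat.gcd x q = 1), g (x : ZMod q)
      = ∑ u : (ZMod q)ˣ, g u := by
  refine Finset.sum_bij (fun x hx => ZMod.unitOfCoprime x (by simpa using (Finset.mem_filter.1 hx).2))
    (by simp) ?_ ?_ ?_
  · intro x hx y hy h
    have h' := congrArg (fun u : (ZMod q)ˣ => (u : ZMod q)) h
    simp only [ZMod.coe_unitOfCoprime] at h'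
    rw [ZMod.natCast_eq_natCast_iff] at h'
    simp only [Finset.mem_filter, Finset.mem_Icc] at hx hy
    have h2 := (Nat.modEq_iff_dvd.1 h')
    obtain ⟨t, ht⟩ := h2
    have hq : (0:ℤ) < q := by exact_mod_cast Nat.pos_of_ne_zero (NeZero.ne q)
    have : t = 0 := by
      have a1 : (q:ℤ) * t < q * 1 := by omega
      have a2 : (q:ℤ) * (-1) < q * t := by omega
      have := lt_of_mul_lt_mul_left a1 hq.le
      have := lt_of_mul_lt_mul_left a2 hq.le
      omega
    subst this
    omega
  · intro u _
    have hc := ZMod.val_coe_unit_coprime u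
    have hlt := ZMod.val_lt (u : ZMod q)
    by_cases h0 : (u : ZMod q).val = 0
    · rw [h0, Nat.coprime_zero_left] at hc
      subst hc
      exact ⟨1, by simp, Subsingleton.elim _ _⟩
    · refine ⟨(u : ZMod q).val, ?_, ?_⟩
      · simp only [Finset.mem_filter, Finset.mem_Icc]
        exact ⟨by omega, hc⟩
      · ext; simp
  · intro x hx
    simp

lemma e_eq (q : ℕ) [NeZero q] (z : ℤ) : e ((z : ℝ) / q) = ZMod.stdAddChar (z : ZMod q) := by
  rw [ZMod.stdAddChar_coe, e]
  push_cast
  congr 1; ring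

lemma S_eq (k q a : ℕ) [NeZero q] : S k q a = G (ZMod.stdAddChar (N := q)) k (a : ZMod q) := by
  unfold S G
  rw [← sum_units q (fun x => ZMod.stdAddChar ((a : ZMod q) * x ^ k))]
  refine Finset.sum_congr rfl fun x _ => ?_
  have := e_eq q ((a * x ^ k : ℕ) : ℤ)
  push_cast at this
  rw [this]

lemma A_eq (n : ℤ) (c q : ℕ) [NeZero q] : A n c q = T (ZMod.stdAddChar (N := q)) c n := by
  unfold A T
  rw [← sum_units q (fun a => (∏ i, G (ZMod.stdAddChar (N := q)) (kk c i) a) *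
    ZMod.stdAddChar (-(a * (n : ZMod q))))]
  refine Finset.sum_congr rfl fun x _ => ?_
  have := e_eq q (-(x * n))
  push_cast at this
  rw [this]
  congr 1
  unfold U
  simp only [S_eq, kk, Fin.prod_univ_succ]
  simp
  ring

lemma A_zero (n : ℤ) (c : ℕ) : A n c 0 = 0 := by simp [A]

lemma A_one (n : ℤ) (c : ℕ) : A n c 1 = 1 := by
  rw [A_eq]
  have h : ∀ x : ZMod 1, ZMod.stdAddChar x = (1 : ℂ) := by
    intro x; rw [Subsingleton.elim x 0]; simp
  simp [T, G, h]

lemma A_mul (n : ℤ) (c : ℕ) {m k : ℕ} (h : Nat.Coprime m k) :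
    A n c (m * k) = A n c m * A n c k := by
  rcases Nat.eq_zero_or_pos m with rfl | hm
  · simp [A_zero]
  rcases Nat.eq_zero_or_pos k with rfl | hk
  · simp [A_zero]
  have : NeZero m := ⟨hm.ne'⟩
  have : NeZero k := ⟨hk.ne'⟩
  have : NeZero (m * k) := ⟨(Nat.mul_pos hm hk).ne'⟩
  obtain ⟨u, v, huv⟩ : ∃ u v : ℤ, u * k + v * m = 1 := by
    obtain ⟨v, u, h⟩ := (Nat.isCoprime_iff_coprime.2 h)
    exact ⟨u, v, by rw [← h]; ring⟩
  have h1 : ((u : ZMod m)) * (k : ZMod m) = 1 := by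
    have := congrArg (fun z : ℤ => (z : ZMod m)) huv
    push_cast at this; simpa using this
  have h2 : ((v : ZMod k)) * (m : ZMod k) = 1 := by
    have := congrArg (fun z : ℤ => (z : ZMod k)) huv
    push_cast at this; simpa using this
  let u' : (ZMod m)ˣ := Units.mkOfMulEqOne _ _ h1
  let v' : (ZMod k)ˣ := Units.mkOfMulEqOne _ _ h2
  rw [A_eq, A_eq, A_eq, ← T_shift _ c n u', ← T_shift (ZMod.stdAddChar (N := k)) c n v']
  refine T_mul (ZMod.chineseRemainder h) _ _ _ ?_ c n
  intro z
  obtain ⟨z, rfl⟩ := ZMod.intCast_surjective z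
  rw [map_intCast (ZMod.chineseRemainder h)]
  simp only [AddChar.mulShift_apply, Prod.fst_intCast, Prod.snd_intCast]
  rw [show (u' : ZMod m) = (u : ZMod m) from rfl, show (v' : ZMod k) = (v : ZMod k) from rfl,
    ← Int.cast_mul, ← Int.cast_mul, ZMod.stdAddChar_coe, ZMod.stdAddChar_coe, ZMod.stdAddChar_coe,
    ← Complex.exp_add]
  congr 1
  have hmC : (m : ℂ) ≠ 0 := by exact_mod_cast hm.ne'
  have hkC : (k : ℂ) ≠ 0 := by exact_mod_cast hk.ne'
  have huvC : (u : ℂ) * k + v * m = 1 := by exact_mod_cast huv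
  push_cast
  field_simp
  linear_combination (-(z : ℂ)) * huvC

lemma A_pow (n : ℤ) (c : ℕ) {p t : ℕ} (hp : p.Prime) (ht : 2 ≤ t) : A n c (p ^ t) = 0 := by
  have : NeZero (p ^ t) := ⟨(pow_pos hp.pos t).ne'⟩
  rw [A_eq]
  unfold T
  refine Finset.sum_eq_zero fun a _ => ?_
  have key : ∀ k : ℕ, p.Coprime k → G (ZMod.stdAddChar (N := p ^ t)) k a = 0 := by
    intro k hk
    refine G_zero _ (ZMod.isPrimitive_stdAddChar _) k ?_ ((p ^ (t - 1) : ℕ) : ZMod (p ^ t)) ?_ ?_ a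
    · rw [ZMod.isUnit_iff_coprime]
      exact (Nat.Coprime.pow_left t hk).symm
    · rw [Ne, ZMod.natCast_eq_zero_iff, Nat.pow_dvd_pow_iff_le_right hp.one_lt]
      omega
    · rw [← Nat.cast_mul, ZMod.natCast_eq_zero_iff, ← pow_add]
      exact pow_dvd_pow p (by omega)
  suffices h : ∏ i, G (ZMod.stdAddChar (N := p ^ t)) (kk c i) a = 0 by rw [h, zero_mul]
  by_cases h5 : p = 5
  · refine Finset.prod_eq_zero (Finset.mem_univ 0) ?_
    exact key 2 (by subst h5; decide)
  · refine Finset.prod_eq_zero (Finset.mem_univ 4) ?_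
    exact key 5 ((Nat.coprime_primes hp (by decide)).2 h5)

lemma A_bound (n : ℤ) (c : ℕ) {p : ℕ} (hp : p.Prime) : ‖A n c p‖ ≤ 1080 * (p:ℝ) ^ 5 := by
  have : Fact p.Prime := ⟨hp⟩
  rw [A_eq]
  unfold T
  have hcard : (Fintype.card (ZMod p)ˣ : ℝ) ≤ p := by
    rw [ZMod.card_units_eq_totient]; exact_mod_cast Nat.totient_le p
  have hb : ∀ k : ℕ, 0 < k → ∀ a : (ZMod p)ˣ,
      ‖G (ZMod.stdAddChar (N := p)) k a‖ ≤ k * √p := by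
    intro k hk a
    have := G_bound _ (ZMod.isPrimitive_stdAddChar p) k hk a
    rw [ZMod.card] at this
    refine le_of_sq_le_sq ?_ (by positivity)
    rwa [mul_pow, Real.sq_sqrt (by positivity)]
  have hs : √(p:ℝ) * √p = p := Real.mul_self_sqrt (by positivity)
  calc _ ≤ ∑ a : (ZMod p)ˣ, (1080 * (p:ℝ) ^ 4) := by
        refine norm_sum_le_of_le _ fun a _ => ?_
        rw [norm_mul, AddChar.norm_apply, mul_one, norm_prod]
        simp only [kk, Fin.prod_univ_succ]
        simp
        have t := (G_triv (ZMod.stdAddChar (N := p)) c (a : ZMod p)).trans hcard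
        calc _ ≤ (2 * √p) * ((2 * √p) * ((3 * √p) * ((3 * √p) * ((5 * √p) * ((6 * √p) * p))))) := by
              gcongr
              · exact hb 2 (by norm_num) a
              · exact hb 2 (by norm_num) a
              · exact hb 3 (by norm_num) a
              · exact hb 3 (by norm_num) a
              · exact hb 5 (by norm_num) a
              · exact hb 6 (by norm_num) a
          _ = 1080 * (√p * √p) ^ 3 * p := by ring
          _ = 1080 * (p:ℝ) ^ 4 := by rw [hs]; ring
    _ = Fintype.card (ZMod p)ˣ * (1080 * (p:ℝ) ^ 4) := by simp
    _ ≤ p * (1080 * (p:ℝ) ^ 4) := by gcongr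
    _ = _ := by ring

lemma image_card {p : ℕ} [Fact p.Prime] (k : ℕ) (hk : 0 < k) :
    p - 1 ≤ k * #(univ.image fun x : (ZMod p)ˣ => ((x : ZMod p)) ^ k) := by
  have h1 : #(univ.image fun x : (ZMod p)ˣ => ((x : ZMod p)) ^ k)
      = #(univ.image fun x : (ZMod p)ˣ => x ^ k) := by
    rw [← Finset.card_image_of_injective (univ.image fun x : (ZMod p)ˣ => x ^ k)
      (Units.val_injective (α := ZMod p)), Finset.image_image]
    rfl
  rw [h1, ← ZMod.card_units p, ← Finset.card_univ]
  exact Finset.card_le_mul_card_image _ k fun b _ => fiber k hk b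

open scoped Pointwise in
lemma solution_large (c : ℕ) (hc : c = 6 ∨ c = 7) {p : ℕ} (hp : p.Prime) (h7 : 7 ≤ p) (n : ZMod p) :
    ∃ x : Fin 7 → (ZMod p)ˣ, ∑ i, ((x i : ZMod p)) ^ (kk c i) = n := by
  have : Fact p.Prime := ⟨hp⟩
  let I : ℕ → Finset (ZMod p) := fun k => univ.image fun x : (ZMod p)ˣ => ((x : ZMod p)) ^ k
  have hI : ∀ k, 0 < k → p - 1 ≤ k * #(I k) := fun k hk => image_card k hk
  have hne : ∀ k, (I k).Nonempty := fun k => (Finset.univ_nonempty).image _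
  have hcd : ∀ s t : Finset (ZMod p), s.Nonempty → t.Nonempty → min p (#s + #t - 1) ≤ #(s + t) :=
    fun s t hs ht => ZMod.cauchy_davenport hp hs ht
  have n1 := (hne 2).add (hne 2)
  have n2 := n1.add (hne 3)
  have n3 := n2.add (hne 3)
  have n4 := n3.add (hne 5)
  have n5 := n4.add (hne 6)
  have c1 := hcd _ _ (hne 2) (hne 2)
  have c2 := hcd _ _ n1 (hne 3)
  have c3 := hcd _ _ n2 (hne 3)
  have c4 := hcd _ _ n3 (hne 5)
  have c5 := hcd _ _ n4 (hne 6)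
  have c6 := hcd _ _ n5 (hne c)
  have i2 := hI 2 (by norm_num)
  have i3 := hI 3 (by norm_num)
  have i5 := hI 5 (by norm_num)
  have i6 := hI 6 (by norm_num)
  have ic : p - 1 ≤ 7 * #(I c) := by
    rcases hc with rfl | rfl
    · exact i6.trans (by omega)
    · exact hI 7 (by norm_num)
  have p2 := (hne 2).card_pos
  have p3 := (hne 3).card_pos
  have p5 := (hne 5).card_pos
  have p6 := (hne 6).card_pos
  have pc := (hne c).card_pos
  have hfin : p ≤ #(I 2 + I 2 + I 3 + I 3 + I 5 + I 6 + I c) := by omega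
  have huniv : I 2 + I 2 + I 3 + I 3 + I 5 + I 6 + I c = univ := by
    rw [← Finset.card_eq_iff_eq_univ, ZMod.card]
    exact le_antisymm ((Finset.card_le_univ _).trans (ZMod.card p).le) hfin
  have hn : n ∈ I 2 + I 2 + I 3 + I 3 + I 5 + I 6 + I c := by rw [huniv]; exact mem_univ _
  simp only [Finset.mem_add, I, Finset.mem_image, Finset.mem_univ, true_and] at hn
  obtain ⟨_, ⟨_, ⟨_, ⟨_, ⟨_, ⟨_, ⟨x1, rfl⟩, _, ⟨x2, rfl⟩, rfl⟩, _, ⟨x3, rfl⟩, rfl⟩, _, ⟨x4, rfl⟩, rfl⟩,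
    _, ⟨x5, rfl⟩, rfl⟩, _, ⟨x6, rfl⟩, rfl⟩, _, ⟨x7, rfl⟩, rfl⟩ := hn
  refine ⟨![x1, x2, x3, x4, x5, x6, x7], ?_⟩
  simp only [kk, Fin.sum_univ_succ]
  simp
  ring

lemma solution (c : ℕ) (hc : c = 6 ∨ c = 7) {p : ℕ} (hp : p.Prime) (n : ℤ) (hn : ¬ 2 ∣ n) :
    ∃ x : Fin 7 → (ZMod p)ˣ, ∑ i, ((x i : ZMod p)) ^ (kk c i) = n := by
  rcases le_or_gt 7 p with h7 | h7
  · exact solution_large c hc hp h7 n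
  have : p = 2 ∨ p = 3 ∨ p = 5 := by
    interval_cases p <;> tauto
  rcases this with rfl | rfl | rfl
  · refine ⟨fun _ => 1, ?_⟩
    have : (n : ZMod 2) = 1 := by
      have h : n = 2 * (n / 2) + 1 := by omega
      rw [h]; push_cast
      rw [show (2 : ZMod 2) = 0 from rfl]; simp
    rw [this]
    simp
    decide
  · have : ∀ m : ZMod 3, ∃ x y z : (ZMod 3)ˣ, 1 + 1 + (x:ZMod 3) ^ 3 + (y:ZMod 3) ^ 3 + (z:ZMod 3) ^ 5
        + 1 + 1 = m := by decide
    obtain ⟨x, y, z, h⟩ := this n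
    refine ⟨![1, 1, x, y, z, 1, 1], ?_⟩
    rw [← h]
    simp only [kk, Fin.sum_univ_succ]
    simp
    ring
  · have : ∀ m : ZMod 5, ∃ x y : (ZMod 5)ˣ, 1 + 1 + (x:ZMod 5) ^ 3 + (y:ZMod 5) ^ 3 + 1
        + 1 + 1 = m := by decide
    obtain ⟨x, y, h⟩ := this n
    refine ⟨![1, 1, x, y, 1, 1, 1], ?_⟩
    rw [← h]
    simp only [kk, Fin.sum_univ_succ]
    simp
    ring

lemma A_lower (c : ℕ) (hc : c = 6 ∨ c = 7) {p : ℕ} (hp : p.Prime) (n : ℤ) (hn : ¬ 2 ∣ n) :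
    ∃ M : ℕ, 1 ≤ M ∧ A n c p + (Nat.totient p : ℂ) ^ 7 = (p * M : ℕ) := by
  have : Fact p.Prime := ⟨hp⟩
  have h := T_count _ (ZMod.isPrimitive_stdAddChar p) c n
  rw [ZMod.card_units_eq_totient, ZMod.card] at h
  rw [A_eq, h]
  refine ⟨_, ?_, by push_cast; rfl⟩
  obtain ⟨x, hx⟩ := solution c hc hp n hn
  exact Finset.card_pos.2 ⟨x, by simpa using hx⟩

noncomputable def ff (n : ℤ) (c q : ℕ) : ℂ := A n c q / (Nat.totient q : ℂ) ^ 7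

lemma ff_zero (n : ℤ) (c : ℕ) : ff n c 0 = 0 := by simp [ff, A_zero]
lemma ff_one (n : ℤ) (c : ℕ) : ff n c 1 = 1 := by simp [ff, A_one]
lemma ff_mul (n : ℤ) (c : ℕ) {m k : ℕ} (h : Nat.Coprime m k) :
    ff n c (m * k) = ff n c m * ff n c k := by
  unfold ff
  rw [A_mul n c h, Nat.totient_mul h]
  push_cast
  rw [mul_pow, mul_div_mul_comm]
lemma ff_pow (n : ℤ) (c : ℕ) {p t : ℕ} (hp : p.Prime) (ht : 2 ≤ t) : ff n c (p ^ t) = 0 := by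
  simp [ff, A_pow n c hp ht]

lemma ff_bound (n : ℤ) (c : ℕ) {p : ℕ} (hp : p.Prime) : ‖ff n c p‖ ≤ 138240 / (p:ℝ) ^ 2 := by
  have hp2 : (2:ℝ) ≤ p := by exact_mod_cast hp.two_le
  have ht : (p:ℝ) / 2 ≤ (Nat.totient p : ℝ) := by
    rw [Nat.totient_prime hp, Nat.cast_sub hp.one_le]; push_cast; linarith
  unfold ff
  rw [norm_div, norm_pow, Complex.norm_natCast]
  calc _ ≤ (1080 * (p:ℝ) ^ 5) / ((p:ℝ) / 2) ^ 7 := by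
        gcongr
        exact A_bound n c hp
    _ = _ := by field_simp; norm_num

lemma hasSum_pows {E : Type} [AddCommMonoid E] [TopologicalSpace E] (f : ℕ → E) (p : ℕ)
    (h : ∀ t, 2 ≤ t → f (p ^ t) = 0) : HasSum (fun t : ℕ => f (p ^ t)) (f 1 + f p) := by
  have : HasSum (fun t : ℕ => f (p ^ t)) (∑ t ∈ range 2, f (p ^ t)) :=
    hasSum_sum_of_ne_finset_zero (f := fun t : ℕ => f (p ^ t)) (s := range 2)
    (fun b hb => h b (by rw [Finset.mem_range] at hb; omega))
  simpa [Finset.sum_range_succ] using this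

lemma sq_summable (C : ℝ) : Summable (fun p : ℕ => C / (p:ℝ) ^ 2) := by
  have : Summable (fun p : ℕ => 1 / (p:ℝ) ^ 2) := Real.summable_one_div_nat_pow.2 (by norm_num)
  simpa [div_eq_mul_inv] using this.mul_left C

lemma ff_summable (n : ℤ) (c : ℕ) : Summable (fun q => ‖ff n c q‖) := by
  have hs := sq_summable 138240
  refine summable_of_sum_range_le (c := Real.exp (∑' p : ℕ, 138240 / (p:ℝ) ^ 2))
    (fun _ => norm_nonneg _) fun N => ?_
  have hp0 : ∀ {p : ℕ}, p.Prime → HasSum (fun t : ℕ => ‖ff n c (p ^ t)‖) (1 + ‖ff n c p‖) := by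
    intro p hp
    have := hasSum_pows (fun q => ‖ff n c q‖) p (fun t ht => by simp [ff_pow n c hp ht])
    simpa [ff_one] using this
  have h := (EulerProduct.summable_and_hasSum_smoothNumbers_prod_primesBelow_tsum
    (f := fun q => ‖ff n c q‖) (by simp [ff_one]) (fun {m k} hmk => by simp [ff_mul n c hmk])
    (fun {p} hp => by simpa using (hp0 hp).summable) N).2
  have h' := (hasSum_subtype_iff_indicator (f := fun q => ‖ff n c q‖)).1 h
  calc ∑ i ∈ range N, ‖ff n c i‖
      ≤ ∑ i ∈ range N, (Nat.smoothNumbers N).indicator (fun q => ‖ff n c q‖) i := by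
        refine Finset.sum_le_sum fun i hi => ?_
        rcases Nat.eq_zero_or_pos i with rfl | hi0
        · simp only [ff_zero, norm_zero]
          exact Set.indicator_nonneg (fun _ _ => norm_nonneg _) _
        · rw [Set.indicator_of_mem]
          exact Nat.mem_smoothNumbers_of_lt hi0 (Finset.mem_range.1 hi)
    _ ≤ _ := sum_le_hasSum _ (fun i _ => Set.indicator_nonneg (fun _ _ => norm_nonneg _) _) h'
    _ ≤ ∏ p ∈ N.primesBelow, Real.exp (138240 / (p:ℝ) ^ 2) := by
        refine Finset.prod_le_prod (fun p _ => tsum_nonneg fun _ => norm_nonneg _) fun p hp => ?_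
        have hp' := Nat.prime_of_mem_primesBelow hp
        rw [(hp0 hp').tsum_eq]
        have := Real.add_one_le_exp (138240 / (p:ℝ) ^ 2)
        linarith [ff_bound n c hp']
    _ = Real.exp (∑ p ∈ N.primesBelow, 138240 / (p:ℝ) ^ 2) := (Real.exp_sum _ _).symm
    _ ≤ _ := by
        gcongr
        exact hs.sum_le_tsum _ fun p _ => by positivity

/-- The local factor is real and bounded below by `exp (-K/p^2)`. -/
lemma factor (c : ℕ) (hc : c = 6 ∨ c = 7) {p : ℕ} (hp : p.Prime) (n : ℤ) (hn : ¬ 2 ∣ n) :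
    ∃ r : ℝ, Real.exp (-((10:ℝ)^20 / (p:ℝ) ^ 2)) ≤ r ∧ 1 + ff n c p = (r : ℂ) := by
  obtain ⟨M, hM, h⟩ := A_lower c hc hp n hn
  have hp2 : (2:ℝ) ≤ p := by exact_mod_cast hp.two_le
  have htpos : (0:ℝ) < (Nat.totient p : ℝ) := by exact_mod_cast Nat.totient_pos.2 hp.pos
  have htle : (Nat.totient p : ℝ) ≤ p := by exact_mod_cast Nat.totient_le p
  have hM' : (1:ℝ) ≤ M := by exact_mod_cast hM
  have heq : 1 + ff n c p = ((p * M / (Nat.totient p : ℝ) ^ 7 : ℝ) : ℂ) := by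
    have ht : (Nat.totient p : ℂ) ≠ 0 := by exact_mod_cast htpos.ne'
    unfold ff
    push_cast at h ⊢
    rw [← h]
    field_simp
    ring
  refine ⟨_, ?_, heq⟩
  by_cases hbig : (276480:ℝ) ≤ (p:ℝ) ^ 2
  · have hb := ff_bound n c hp
    have hf : ff n c p = ((p * M / (Nat.totient p : ℝ) ^ 7 - 1 : ℝ) : ℂ) := by
      rw [Complex.ofReal_sub, ← heq]; simp
    rw [hf, Complex.norm_real, Real.norm_eq_abs] at hb
    have hb' := (abs_le.1 hb).1
    set x : ℝ := 138240 / (p:ℝ) ^ 2 with hx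
    have hx0 : 0 < x := by positivity
    have hx1 : x ≤ 1 / 2 := by rw [hx, div_le_iff₀ (by positivity)]; linarith
    have h1 : Real.exp (-((10:ℝ)^20 / (p:ℝ) ^ 2)) ≤ Real.exp (-(2 * x)) := by
      apply Real.exp_le_exp.2
      apply neg_le_neg
      rw [hx, ← mul_div_assoc]
      gcongr
      norm_num
    have h2 : Real.exp (-(2 * x)) ≤ 1 - x := by
      rw [Real.exp_neg]
      have := Real.add_one_le_exp (2 * x)
      rw [inv_le_comm₀ (Real.exp_pos _) (by linarith)]
      refine le_trans ?_ this
      rw [inv_le_iff_one_le_mul₀ (by linarith)]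
      nlinarith
    linarith
  · push Not at hbig
    have hplt : (p:ℝ) < 1000 := by nlinarith
    have h1 : Real.exp (-((10:ℝ)^20 / (p:ℝ) ^ 2)) ≤ ((p:ℝ) ^ 6)⁻¹ := by
      rw [Real.exp_neg]
      refine inv_anti₀ (by positivity) ?_
      have ha : (p:ℝ) ≤ Real.exp p := by linarith [Real.add_one_le_exp (p:ℝ)]
      calc (p:ℝ) ^ 6 ≤ Real.exp p ^ 6 := by gcongr
        _ = Real.exp (6 * p) := by rw [← Real.exp_nat_mul]; norm_num
        _ ≤ _ := by
          apply Real.exp_le_exp.2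
          rw [le_div_iff₀ (by positivity)]
          calc 6 * (p:ℝ) * (p:ℝ) ^ 2 ≤ 6 * 1000 * 1000 ^ 2 := by gcongr
            _ ≤ _ := by norm_num
    refine h1.trans ?_
    calc ((p:ℝ) ^ 6)⁻¹ = p * 1 / (p:ℝ) ^ 7 := by field_simp
      _ ≤ _ := by gcongr

lemma main_lower (c : ℕ) (hc : c = 6 ∨ c = 7) (n : ℤ) (hn : ¬ 2 ∣ n) :
    Real.exp (-∑' p : ℕ, (10:ℝ)^20 / (p:ℝ) ^ 2) ≤ (∑' q : ℕ, ff n c q).re := by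
  have hprod := EulerProduct.eulerProduct_hasProd (f := ff n c) (ff_one n c)
    (fun {m k} h => ff_mul n c h) (ff_summable n c) (ff_zero n c)
  have hloc : ∀ p : Nat.Primes, ∃ r : ℝ, Real.exp (-((10:ℝ)^20 / ((p:ℕ):ℝ) ^ 2)) ≤ r ∧
      ∑' t : ℕ, ff n c ((p:ℕ) ^ t) = (r : ℂ) := by
    intro p
    obtain ⟨r, h1, h2⟩ := factor c hc p.2 n hn
    refine ⟨r, h1, ?_⟩
    rw [(hasSum_pows (ff n c) p (fun t ht => ff_pow n c p.2 ht)).tsum_eq, ff_one, h2]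
  choose r hr1 hr2 using hloc
  have hs := sq_summable ((10:ℝ)^20)
  have hs' : Summable (fun p : Nat.Primes => (10:ℝ)^20 / ((p:ℕ):ℝ) ^ 2) :=
    hs.comp_injective Subtype.val_injective
  have hlim := (Complex.continuous_re.tendsto _).comp hprod
  refine ge_of_tendsto hlim (Filter.Eventually.of_forall fun s => ?_)
  simp only [Function.comp, hr2]
  rw [← Complex.ofReal_prod, Complex.ofReal_re]
  calc _ ≤ Real.exp (∑ p ∈ s, -((10:ℝ)^20 / ((p:ℕ):ℝ) ^ 2)) := by
        apply Real.exp_le_exp.2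
        rw [Finset.sum_neg_distrib]
        apply neg_le_neg
        refine (hs'.sum_le_tsum s fun p _ => by positivity).trans ?_
        exact hs.tsum_subtype_le (fun p : ℕ => (10:ℝ)^20 / (p:ℝ) ^ 2) {p | p.Prime} (fun p => by positivity)
    _ = ∏ p ∈ s, Real.exp (-((10:ℝ)^20 / ((p:ℕ):ℝ) ^ 2)) := Real.exp_sum _ _
    _ ≤ _ := Finset.prod_le_prod (fun _ _ => (Real.exp_pos _).le) fun p _ => hr1 p

end SS

/-- The singular series `𝔖_c(n) = Σ_{q≥1} A_{n,c}(q)/φ(q)^7` converges absolutely,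
and `𝔖_c(n) ≥ κ > 0` for all large odd `n` (in particular its real part is `≥ κ`). -/
theorem singular_series (c : ℕ) (hc : c = 6 ∨ c = 7) :
    (∀ n : ℤ, Summable (fun q : ℕ => ‖A n c (q + 1) / (Nat.totient (q + 1) : ℂ) ^ 7‖)) ∧
    ∃ κ : ℝ, 0 < κ ∧ ∃ N : ℤ, ∀ n : ℤ, N ≤ n → ¬ 2 ∣ n →
      κ ≤ (∑' q : ℕ, A n c (q + 1) / (Nat.totient (q + 1) : ℂ) ^ 7).re := by
  constructor
  · intro n
    exact (summable_nat_add_iff (f := fun q => ‖SS.ff n c q‖) 1).2 (SS.ff_summable n c)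
  · refine ⟨_, Real.exp_pos (-∑' p : ℕ, (10:ℝ)^20 / (p:ℝ) ^ 2), 0, fun n _ hn => ?_⟩
    refine (SS.main_lower c hc n hn).trans_eq ?_
    rw [(SS.ff_summable n c).of_norm.tsum_eq_zero_add, SS.ff_zero, zero_add]
    rfl
end

section
/- Fix c ∈ {6, 7}. There exist a constant κ > 0 and N such that for every integer n ≥ N, the integral ∫_{−1/2}^{1/2} w_c(β) e(−β n) dβ is a nonnegative real number and is ≥ κ · n^{Θ_c − θ_c/5}. -/
open MeasureTheory Finset

/-- The polynomial whose value at `e β` is `v n k β`. -/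
noncomputable def vpoly (n k : ℕ) : Polynomial ℝ :=
  ∑ m ∈ (Finset.Icc 1 n).filter (fun m : ℕ => (n : ℝ) / 2 ^ k < (m : ℝ)),
    Polynomial.monomial m ((k : ℝ)⁻¹ * (m : ℝ) ^ ((k : ℝ)⁻¹ - 1))

lemma e_mul_nat (β : ℝ) (m : ℕ) : e (β * m) = e β ^ m := by
  unfold e
  rw [← Complex.exp_nat_mul]
  congr 1
  push_cast
  ring

lemma v_eq_eval (n k : ℕ) (β : ℝ) :
    v n k β = (vpoly n k).eval₂ Complex.ofRealHom (e β) := by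
  unfold v vpoly
  rw [Polynomial.eval₂_finsetSum, Finset.mul_sum]
  refine Finset.sum_congr rfl fun m _ => ?_
  rw [Polynomial.eval₂_monomial, e_mul_nat]
  simp only [Complex.ofRealHom_eq_coe, Complex.ofReal_mul, Complex.ofReal_inv,
    Complex.ofReal_natCast]
  ring

lemma integral_e_int (m n : ℕ) :
    (∫ β in (-(1 : ℝ) / 2)..(1 / 2), e β ^ m * e (-(β * n))) = if m = n then 1 else 0 := by
  have h : ∀ β : ℝ, e β ^ m * e (-(β * n)) =
      Complex.exp ((2 * Real.pi * Complex.I * ((m : ℂ) - n)) * β) := by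
    intro β
    unfold e
    rw [← Complex.exp_nat_mul, ← Complex.exp_add]
    congr 1
    push_cast
    ring
  simp_rw [h]
  split_ifs with hmn
  · subst hmn
    simp
    norm_num
  · have hne : (m : ℂ) - n ≠ 0 := by
      rw [sub_ne_zero]
      exact_mod_cast hmn
    have hc : (2 * Real.pi * Complex.I * ((m : ℂ) - n)) ≠ 0 :=
      mul_ne_zero Complex.two_pi_I_ne_zero hne
    rw [integral_exp_mul_complex hc, div_eq_zero_iff]
    left
    rw [sub_eq_zero, Complex.exp_eq_exp_iff_exists_int]
    refine ⟨(m : ℤ) - n, ?_⟩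
    push_cast
    ring

lemma continuous_e : Continuous e := by
  unfold e
  fun_prop

lemma integral_poly (p : Polynomial ℝ) (n : ℕ) :
    (∫ β in (-(1 : ℝ) / 2)..(1 / 2), p.eval₂ Complex.ofRealHom (e β) * e (-(β * n))) =
      ((p.coeff n : ℝ) : ℂ) := by
  have he := continuous_e
  simp_rw [Polynomial.eval₂_eq_sum_range, Finset.sum_mul]
  rw [intervalIntegral.integral_finsetSum]
  · simp_rw [mul_assoc, intervalIntegral.integral_const_mul, integral_e_int]
    simp only [mul_ite, mul_one, mul_zero, Finset.sum_ite_eq']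
    split_ifs with h
    · rfl
    · rw [Polynomial.coeff_eq_zero_of_natDegree_lt]
      · simp
      · simpa using h
  · intro i _
    apply Continuous.intervalIntegrable
    have : Continuous fun x : ℝ => e (-(x * n)) := he.comp (by fun_prop)
    fun_prop

lemma vpoly_coeff (n k m : ℕ) : (vpoly n k).coeff m =
    if (1 ≤ m ∧ m ≤ n) ∧ (n : ℝ) / 2 ^ k < (m : ℝ) then
      (k : ℝ)⁻¹ * (m : ℝ) ^ ((k : ℝ)⁻¹ - 1) else 0 := by
  unfold vpoly
  simp only [Polynomial.finsetSum_coeff, Polynomial.coeff_monomial, Finset.sum_ite_eq',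
    Finset.mem_filter, Finset.mem_Icc]

lemma vpoly_nonneg (n k m : ℕ) : 0 ≤ (vpoly n k).coeff m := by
  rw [vpoly_coeff]
  split_ifs <;> positivity

/-- Lower bound for the coefficients of `vpoly`. -/
lemma vpoly_lower (n k : ℕ) (hk : 1 ≤ k) (x : ℕ) (hx : 64 ≤ x * 2 ^ k) (m : ℕ)
    (h1 : x * n < 64 * m) (h2 : m ≤ n) :
    (k : ℝ)⁻¹ * (n : ℝ) ^ ((k : ℝ)⁻¹ - 1) ≤ (vpoly n k).coeff m := by
  have hm : 1 ≤ m := by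
    rcases Nat.eq_zero_or_pos m with h | h
    · subst h; simp at h1
    · exact h
  have hlt : (n : ℝ) / 2 ^ k < (m : ℝ) := by
    rw [div_lt_iff₀ (by positivity)]
    have : n < m * 2 ^ k := by
      have a1 : 64 * n ≤ x * 2 ^ k * n := Nat.mul_le_mul_right _ hx
      have a2 : x * n * 2 ^ k < 64 * m * 2 ^ k := Nat.mul_lt_mul_of_pos_right h1 (by positivity)
      nlinarith
    exact_mod_cast this
  rw [vpoly_coeff, if_pos ⟨⟨hm, h2⟩, hlt⟩]
  apply mul_le_mul_of_nonneg_left _ (by positivity)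
  apply Real.rpow_le_rpow_of_nonpos
  · exact_mod_cast hm
  · exact_mod_cast h2
  · have : (k : ℝ)⁻¹ ≤ 1 := inv_le_one_of_one_le₀ (by exact_mod_cast hk)
    linarith

lemma mul_nonneg_coeff {p q : Polynomial ℝ} (hp : ∀ m, 0 ≤ p.coeff m)
    (hq : ∀ m, 0 ≤ q.coeff m) (m : ℕ) : 0 ≤ (q * p).coeff m := by
  rw [Polynomial.coeff_mul]
  exact Finset.sum_nonneg fun i _ => mul_nonneg (hq _) (hp _)

/-- One convolution step. -/
lemma mul_lower {p q : Polynomial ℝ} (hp : ∀ m, 0 ≤ p.coeff m)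
    (hq : ∀ m, 0 ≤ q.coeff m) (n x y s : ℕ) {a b : ℝ} (ha : 0 ≤ a) (hb : 0 ≤ b)
    (hpl : ∀ m, x * n < 64 * m → 64 * m ≤ y * n → b ≤ p.coeff m)
    (hql : ∀ m, s * n < 64 * m → 64 * m ≤ (s + 1) * n → a ≤ q.coeff m) (m : ℕ)
    (h1 : (x + s + 1) * n < 64 * m) (h2 : 64 * m ≤ (y + s) * n) :
    a * b * ((n / 64 : ℕ) : ℝ) ≤ (q * p).coeff m := by
  rw [Polynomial.coeff_mul]
  set J := Finset.Ioc (s * n / 64) (s * n / 64 + n / 64) with hJ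
  have hmem : ∀ j ∈ J, s * n < 64 * j ∧ 64 * j ≤ (s + 1) * n := by
    intro j hj
    rw [hJ, Finset.mem_Ioc] at hj
    rw [add_mul, one_mul]
    omega
  have hle : ∀ j ∈ J, j ≤ m := by
    intro j hj
    have := hmem j hj
    have : (s + 1) * n ≤ (x + s + 1) * n := Nat.mul_le_mul_right _ (by omega)
    omega
  have hinj : Set.InjOn (fun j => (j, m - j)) (J : Set ℕ) := by
    intro i _ j _ h
    exact (Prod.ext_iff.mp h).1
  calc a * b * ((n / 64 : ℕ) : ℝ) = ∑ j ∈ J, a * b := by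
        rw [Finset.sum_const, hJ, Nat.card_Ioc, nsmul_eq_mul]
        simp [mul_comm]
    _ ≤ ∑ j ∈ J, q.coeff j * p.coeff (m - j) := by
        refine Finset.sum_le_sum fun j hj => ?_
        have hj1 := hmem j hj
        have hj2 := hle j hj
        simp only [add_mul, one_mul] at h1 h2 hj1
        refine mul_le_mul (hql j ?_ ?_) (hpl _ ?_ ?_) hb (hq _)
        · omega
        · rw [add_mul, one_mul]; omega
        · omega
        · omega
    _ = ∑ z ∈ J.image (fun j => (j, m - j)), q.coeff z.1 * p.coeff z.2 := by
        rw [Finset.sum_image hinj]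
    _ ≤ _ := by
        refine Finset.sum_le_sum_of_subset_of_nonneg ?_ fun _ _ _ => mul_nonneg (hq _) (hp _)
        intro z hz
        rw [Finset.mem_image] at hz
        obtain ⟨j, hj, rfl⟩ := hz
        rw [Finset.HasAntidiagonal.mem_antidiagonal]
        have := hle j hj
        simp only
        omega

/-- The lower bound `(1/k) n^(1/k-1)` for the coefficients. -/
noncomputable def lb (n k : ℕ) : ℝ := (k : ℝ)⁻¹ * (n : ℝ) ^ ((k : ℝ)⁻¹ - 1)

lemma lb_nonneg (n k : ℕ) : 0 ≤ lb n k := by unfold lb; positivity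

lemma step_lower {p : Polynomial ℝ} (hp : ∀ m, 0 ≤ p.coeff m) (n x y s k : ℕ) (hk : 1 ≤ k)
    (hs : 64 ≤ s * 2 ^ k) (hs' : s < 64) {b : ℝ} (hb : 0 ≤ b)
    (hpl : ∀ m, x * n < 64 * m → 64 * m ≤ y * n → b ≤ p.coeff m) (m : ℕ)
    (h1 : (x + s + 1) * n < 64 * m) (h2 : 64 * m ≤ (y + s) * n) :
    lb n k * b * ((n / 64 : ℕ) : ℝ) ≤ (vpoly n k * p).coeff m := by
  refine mul_lower hp (vpoly_nonneg n k) n x y s (lb_nonneg n k) hb hpl ?_ m h1 h2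
  intro j hj1 hj2
  refine vpoly_lower n k hk s hs j hj1 ?_
  have : (s + 1) * n ≤ 64 * n := Nat.mul_le_mul_right _ (by omega)
  omega

lemma coeff_lower (n c : ℕ) (hn : 0 < n) (hc : 6 ≤ c) :
    lb n 2 ^ 2 * lb n 3 ^ 2 * lb n 6 * lb n c * ((n / 64 : ℕ) : ℝ) ^ 5 ≤
      (vpoly n 2 ^ 2 * vpoly n 3 ^ 2 * vpoly n 6 * vpoly n c).coeff n := by
  have hM : (0 : ℝ) ≤ ((n / 64 : ℕ) : ℝ) := by positivity
  have l2 := lb_nonneg n 2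
  have l3 := lb_nonneg n 3
  have l6 := lb_nonneg n 6
  have lc := lb_nonneg n c
  have hc2 : 64 ≤ 1 * 2 ^ c := by
    rw [one_mul]
    calc 64 = 2 ^ 6 := by norm_num
      _ ≤ 2 ^ c := Nat.pow_le_pow_right (by norm_num) hc
  have n1 := vpoly_nonneg n 2
  have n2 := mul_nonneg_coeff n1 (vpoly_nonneg n 2)
  have n3 := mul_nonneg_coeff n2 (vpoly_nonneg n 3)
  have n4 := mul_nonneg_coeff n3 (vpoly_nonneg n 3)
  have n5 := mul_nonneg_coeff n4 (vpoly_nonneg n 6)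
  have s1 : ∀ m, 16 * n < 64 * m → 64 * m ≤ 64 * n → lb n 2 ≤ (vpoly n 2).coeff m :=
    fun m h1 h2 => vpoly_lower n 2 (by norm_num) 16 (by norm_num) m h1 (by omega)
  have s2 := step_lower n1 n 16 64 16 2 (by norm_num) (by norm_num) (by norm_num) l2 s1
  have s3 := step_lower n2 n _ _ 8 3 (by norm_num) (by norm_num) (by norm_num) (by positivity) s2
  have s4 := step_lower n3 n _ _ 8 3 (by norm_num) (by norm_num) (by norm_num) (by positivity) s3
  have s5 := step_lower n4 n _ _ 1 6 (by norm_num) (by norm_num) (by norm_num) (by positivity) s4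
  have s6 := step_lower n5 n _ _ 1 c (by omega) hc2 (by norm_num) (by positivity) s5 n
    (by omega) (by omega)
  convert s6 using 1
  · ring
  · congr 1
    ring

/-- `∫_{-1/2}^{1/2} w_c(β) e(-βn) dβ` is a nonnegative real number, and it is
`≥ κ n^{Θ_c - θ_c/5}` for all large `n`. -/
theorem w_integral_lower_bound (c : ℕ) (hc : c = 6 ∨ c = 7) :
    ∃ κ : ℝ, 0 < κ ∧ ∃ N : ℕ, ∀ n : ℕ, N ≤ n →
      (∫ β in (-(1 : ℝ) / 2)..(1 / 2), w n c β * e (-(β * n))).im = 0 ∧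
      κ * (n : ℝ) ^ (Θ c - θ c / 5) ≤
        (∫ β in (-(1 : ℝ) / 2)..(1 / 2), w n c β * e (-(β * n))).re := by
  have hc6 : 6 ≤ c := by omega
  have hc0 : (0 : ℝ) < c := by exact_mod_cast (by omega : 0 < c)
  refine ⟨(2 : ℝ)⁻¹ ^ 2 * (3 : ℝ)⁻¹ ^ 2 * (6 : ℝ)⁻¹ * (c : ℝ)⁻¹ * (128 : ℝ)⁻¹ ^ 5,
    by positivity, 64, fun n hn => ?_⟩
  have hint : (∫ β in (-(1 : ℝ) / 2)..(1 / 2), w n c β * e (-(β * n))) =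
      (((vpoly n 2 ^ 2 * vpoly n 3 ^ 2 * vpoly n 6 * vpoly n c).coeff n : ℝ) : ℂ) := by
    rw [← integral_poly]
    simp only [w, v_eq_eval, Polynomial.eval₂_mul, Polynomial.eval₂_pow]
  rw [hint, Complex.ofReal_im, Complex.ofReal_re]
  refine ⟨rfl, le_trans ?_ (coeff_lower n c (by omega) hc6)⟩
  have hn0 : (0 : ℝ) < n := by exact_mod_cast (by omega : 0 < n)
  have hM : (128 : ℝ)⁻¹ * n ≤ ((n / 64 : ℕ) : ℝ) := by
    have h : n ≤ 128 * (n / 64) := by omega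
    have h' : (n : ℝ) ≤ 128 * ((n / 64 : ℕ) : ℝ) := by exact_mod_cast h
    linarith
  have l2 := lb_nonneg n 2
  have l3 := lb_nonneg n 3
  have l6 := lb_nonneg n 6
  have lc := lb_nonneg n c
  refine le_trans (le_of_eq ?_) (mul_le_mul_of_nonneg_left
    (pow_le_pow_left₀ (by positivity) hM 5) (by positivity))
  have hexp : (n : ℝ) ^ (Θ c - θ c / 5) =
      ((n : ℝ) ^ (((2 : ℕ) : ℝ)⁻¹ - 1)) ^ 2 * ((n : ℝ) ^ (((3 : ℕ) : ℝ)⁻¹ - 1)) ^ 2 *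
        (n : ℝ) ^ (((6 : ℕ) : ℝ)⁻¹ - 1) * (n : ℝ) ^ ((c : ℝ)⁻¹ - 1) * (n : ℝ) ^ 5 := by
    simp only [← Real.rpow_natCast, ← Real.rpow_mul hn0.le, ← Real.rpow_add hn0]
    congr 1
    unfold Θ
    push_cast
    ring
  rw [hexp]
  unfold lb
  push_cast
  ring
end

section
/- Fix c ∈ {6, 7} and ε > 0. There exists a constant C > 0 such that for every sufficiently large integer n, the number T_c of 6-tuples (y1, y2, z1, z2, z3, z4) of positive integers satisfying y1^c − y2^c = z1^5 + z2^5 − z3^5 − z4^5, with P_c/2 < y_i ≤ P_c for i = 1, 2 and 1 ≤ z_j ≤ P_5^{θ_c} for j = 1, 2, 3, 4, satisfies T_c ≤ C · P_c^{1+ε} · P_5^{2θ_c}. -/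
open MeasureTheory Finset

/-- The divisor bound. -/
theorem tb_div (ε : ℝ) (hε : 0 < ε) : ∃ C : ℝ, 1 ≤ C ∧ ∀ m : ℕ, m ≠ 0 →
    (#m.divisors : ℝ) ≤ C * (m : ℝ) ^ ε := by
  set B : ℝ := max 1 (1 / (ε * Real.log 2)) with hB
  have hlog : 0 < Real.log 2 := Real.log_pos (by norm_num)
  have hB1 : 1 ≤ B := le_max_left _ _
  have hB2 : 1 ≤ B * (ε * Real.log 2) := by
    have h : 1 / (ε * Real.log 2) ≤ B := le_max_right _ _
    rwa [div_le_iff₀ (by positivity)] at h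
  set M : ℕ := ⌈(2 : ℝ) ^ (1 / ε)⌉₊ with hM
  refine ⟨B ^ M, one_le_pow₀ hB1, fun m hm => ?_⟩
  rw [Nat.card_divisors hm]
  have key : ∀ p ∈ m.primeFactors, ((m.factorization p + 1 : ℕ) : ℝ) ≤
      (if p < M then B else 1) * (((p ^ m.factorization p : ℕ) : ℝ) ^ ε) := by
    intro p hp
    have hp2 : 2 ≤ p := (Nat.prime_of_mem_primeFactors hp).two_le
    have hp2' : (2 : ℝ) ≤ p := by exact_mod_cast hp2
    set a := m.factorization p
    have e1 : (((p ^ a : ℕ) : ℝ) ^ ε) = ((p : ℝ) ^ ε) ^ a := by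
      push_cast
      rw [← Real.rpow_natCast, ← Real.rpow_natCast, ← Real.rpow_mul (by positivity),
        ← Real.rpow_mul (by positivity), mul_comm]
    rw [e1]
    split_ifs with h
    · have h1 : 1 + ε * Real.log 2 ≤ (p : ℝ) ^ ε := by
        calc 1 + ε * Real.log 2 ≤ Real.exp (ε * Real.log 2) := by
              linarith [Real.add_one_le_exp (ε * Real.log 2)]
          _ = (2 : ℝ) ^ ε := by rw [Real.rpow_def_of_pos (by norm_num), mul_comm]
          _ ≤ _ := Real.rpow_le_rpow (by norm_num) hp2' hε.le
      have h2 : 1 + (a : ℝ) * (ε * Real.log 2) ≤ ((p : ℝ) ^ ε) ^ a := by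
        calc _ ≤ (1 + ε * Real.log 2) ^ a := one_add_mul_le_pow (by
                have : 0 < ε * Real.log 2 := by positivity
                linarith) a
          _ ≤ _ := by gcongr
      have h3 : (a : ℝ) ≤ a * (B * (ε * Real.log 2)) := le_mul_of_one_le_right (by positivity) hB2
      push_cast
      nlinarith
    · have h1 : (2 : ℝ) ≤ (p : ℝ) ^ ε := by
        have h2 : (2 : ℝ) ^ (1 / ε) ≤ p := (Nat.le_ceil _).trans (by exact_mod_cast not_lt.mp h)
        calc (2 : ℝ) = ((2 : ℝ) ^ (1 / ε)) ^ ε := by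
              rw [← Real.rpow_mul (by norm_num), one_div, inv_mul_cancel₀ hε.ne', Real.rpow_one]
          _ ≤ _ := Real.rpow_le_rpow (by positivity) h2 hε.le
      have h2 : ((a + 1 : ℕ) : ℝ) ≤ (2 : ℝ) ^ a := by
        exact_mod_cast Nat.lt_two_pow_self
      rw [one_mul]
      exact h2.trans (by gcongr)
  push_cast at key ⊢
  calc _ ≤ ∏ p ∈ m.primeFactors, ((if p < M then B else 1) * (((p : ℝ) ^ m.factorization p) ^ ε)) :=
        Finset.prod_le_prod (fun _ _ => by positivity) key
    _ = (∏ p ∈ m.primeFactors, (if p < M then B else 1)) *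
        (∏ p ∈ m.primeFactors, ((p : ℝ) ^ m.factorization p)) ^ ε := by
        rw [Finset.prod_mul_distrib, Real.finsetProd_rpow _ _ (fun _ _ => by positivity)]
    _ ≤ B ^ M * (m : ℝ) ^ ε := by
        have hm' : (∏ p ∈ m.primeFactors, ((p : ℝ) ^ m.factorization p)) = m := by
          conv_rhs => rw [← Nat.prod_factorization_pow_eq_self hm]
          rw [Finsupp.prod]
          push_cast
          rfl
        rw [hm']
        gcongr
        rw [Finset.prod_ite, Finset.prod_const, Finset.prod_const_one, mul_one]
        apply pow_le_pow_right₀ hB1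
        calc _ ≤ #(Finset.range M) := Finset.card_le_card (by
                intro x hx
                simp only [Finset.mem_filter] at hx
                exact Finset.mem_range.mpr hx.2)
          _ = M := by simp

theorem tb_cnt {α β γ : Type*} [DecidableEq γ] (S : Finset α) (T : Finset β) (f : α → γ)
    (g : β → γ) (M : Finset γ) (hM : ∀ a ∈ S, f a ∈ M) :
    #((S ×ˢ T).filter (fun p => f p.1 = g p.2)) =
      ∑ m ∈ M, #(S.filter (fun a => f a = m)) * #(T.filter (fun b => g b = m)) := by
  rw [Finset.card_eq_sum_card_fiberwise (f := fun p => f p.1) (t := M)]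
  · refine Finset.sum_congr rfl fun m _ => ?_
    rw [← Finset.card_product]
    congr 1
    ext ⟨a, b⟩
    simp only [Finset.mem_filter, Finset.mem_product]
    constructor
    · rintro ⟨⟨⟨h1, h2⟩, h3⟩, h4⟩
      exact ⟨⟨h1, h4⟩, h2, h3 ▸ h4⟩
    · rintro ⟨⟨h1, h4⟩, h2, h3⟩
      exact ⟨⟨⟨h1, h2⟩, h4.trans h3.symm⟩, h4⟩
  · intro p hp
    simp only [Finset.coe_filter, Finset.mem_product, Set.mem_ofPred_eq] at hp
    exact hM _ hp.1.1

theorem tb_cs0 {α β γ : Type*} [DecidableEq γ] (S : Finset α) (T : Finset β) (f : α → γ)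
    (g : β → γ) :
    #((S ×ˢ T).filter (fun p => f p.1 = g p.2)) ^ 2 ≤
      #((S ×ˢ S).filter (fun p => f p.1 = f p.2)) *
      #((T ×ˢ T).filter (fun p => g p.1 = g p.2)) := by
  have h1 : ∀ a ∈ S, f a ∈ S.image f ∪ T.image g := fun a ha =>
    Finset.mem_union_left _ (Finset.mem_image_of_mem _ ha)
  have h2 : ∀ a ∈ T, g a ∈ S.image f ∪ T.image g := fun a ha =>
    Finset.mem_union_right _ (Finset.mem_image_of_mem _ ha)
  rw [tb_cnt S T f g _ h1, tb_cnt S S f f _ h1, tb_cnt T T g g _ h2]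
  simp only [← sq]
  exact Finset.sum_mul_sq_le_sq_mul_sq _ _ _

theorem tb_cs1 {α γ δ : Type*} [DecidableEq γ] [DecidableEq δ] (S : Finset α) (f : α → γ)
    (κ : α → δ) (K : Finset δ) (hK : ∀ a ∈ S, κ a ∈ K) :
    #((S ×ˢ S).filter (fun p => f p.1 = f p.2)) ≤
      #K * #((S ×ˢ S).filter (fun p => f p.1 = f p.2 ∧ κ p.1 = κ p.2)) := by
  have h1 : ∀ a ∈ S, f a ∈ S.image f := fun a ha => Finset.mem_image_of_mem _ ha
  have h2 : ∀ a ∈ S, (f a, κ a) ∈ S.image f ×ˢ K := fun a ha =>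
    Finset.mk_mem_product (h1 a ha) (hK a ha)
  have h3 := tb_cnt S S (fun a => (f a, κ a)) (fun a => (f a, κ a)) _ h2
  simp only [Prod.mk.injEq] at h3
  rw [tb_cnt S S f f _ h1, h3, Finset.sum_product, Finset.mul_sum]
  refine Finset.sum_le_sum fun m _ => ?_
  have h4 : #(S.filter (fun a => f a = m)) = ∑ k ∈ K, #(S.filter (fun a => f a = m ∧ κ a = k)) := by
    rw [Finset.card_eq_sum_card_fiberwise (f := κ) (t := K)]
    · simp only [Finset.filter_filter]
    · intro a ha
      simp only [Finset.coe_filter, Set.mem_ofPred_eq] at ha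
      exact hK a ha.1
  rw [h4]
  simp only [← sq, Prod.mk.injEq]
  exact sq_sum_le_card_mul_sum_sq (s := K) (f := fun k => #(S.filter (fun a => f a = m ∧ κ a = k)))

/-- signed divisors -/
def tb_sdiv (m : ℤ) : Finset ℤ :=
  m.natAbs.divisors.image (fun d : ℕ => (d : ℤ)) ∪ m.natAbs.divisors.image (fun d : ℕ => -(d : ℤ))

theorem tb_sdiv_card (m : ℤ) : #(tb_sdiv m) ≤ 2 * #m.natAbs.divisors := by
  unfold tb_sdiv
  refine (Finset.card_union_le _ _).trans ?_
  rw [two_mul]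
  exact add_le_add Finset.card_image_le Finset.card_image_le

theorem tb_mem_sdiv {m d : ℤ} (hm : m ≠ 0) (hd : d ∣ m) : d ∈ tb_sdiv m := by
  have h : d.natAbs ∈ m.natAbs.divisors :=
    Nat.mem_divisors.mpr ⟨Int.natAbs_dvd_natAbs.mpr hd, Int.natAbs_ne_zero.mpr hm⟩
  unfold tb_sdiv
  rw [Finset.mem_union, Finset.mem_image, Finset.mem_image]
  rcases Int.natAbs_eq d with h' | h'
  · exact Or.inl ⟨_, h, h'.symm⟩
  · exact Or.inr ⟨_, h, h'.symm⟩

theorem tb_W1 (c : ℕ) (hc : c = 5 ∨ c = 6 ∨ c = 7) (y h k : ℤ) (hy : 0 < y) (hh : 0 < h)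
    (hk : 0 < k) : 0 < (y + k + h) ^ c - (y + k) ^ c - (y + h) ^ c + y ^ c := by
  rcases hc with rfl | rfl | rfl <;> ring_nf <;> positivity

theorem tb_W2 (c : ℕ) (hc : c = 5 ∨ c = 6 ∨ c = 7) (y h k t : ℤ) (hy : 0 < y) (hh : 0 < h)
    (hk : 0 < k) (ht : 0 < t) : 0 < (y + t + k + h) ^ c - (y + t + k) ^ c - (y + t + h) ^ c + (y + t) ^ c
      - ((y + k + h) ^ c - (y + k) ^ c - (y + h) ^ c + y ^ c) := by
  rcases hc with rfl | rfl | rfl <;> ring_nf <;> positivity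

theorem tb_inj1_aux (c : ℕ) (hc : c = 5 ∨ c = 6 ∨ c = 7) (a b a' b' : ℤ) (ha : 0 < a) (hb : 0 < b)
    (h : a - b = a' - b') (hab : a ≠ b) (hlt : b < b') :
    a ^ c - b ^ c ≠ a' ^ c - b' ^ c := by
  intro h0
  rcases lt_or_gt_of_ne hab with h1 | h1
  · have := tb_W1 c hc a (b - a) (b' - b) ha (by linarith) (by linarith)
    rw [show a + (b' - b) + (b - a) = b' by ring, show a + (b' - b) = a' by linarith,
      show a + (b - a) = b by ring] at this
    linarith
  · have := tb_W1 c hc b (a - b) (b' - b) hb (by linarith) (by linarith)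
    rw [show b + (b' - b) + (a - b) = a' by linarith, show b + (b' - b) = b' by linarith,
      show b + (a - b) = a by ring] at this
    linarith

theorem tb_inj1 (c : ℕ) (hc : c = 5 ∨ c = 6 ∨ c = 7) (a b a' b' : ℤ) (ha : 0 < a) (hb : 0 < b)
    (ha' : 0 < a') (hb' : 0 < b')
    (h : a - b = a' - b') (hab : a ≠ b) (hne : b ≠ b') :
    a ^ c - b ^ c ≠ a' ^ c - b' ^ c := by
  rcases lt_or_gt_of_ne hne with h1 | h1
  · exact tb_inj1_aux c hc a b a' b' ha hb h hab h1
  · exact (tb_inj1_aux c hc a' b' a b ha' hb' h.symm (fun h2 => hab (by linarith)) h1).symm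

theorem tb_inj2_aux (c : ℕ) (hc : c = 5 ∨ c = 6 ∨ c = 7) (b h k t : ℤ) (h1 : 0 < b)
    (h2 : 0 < b + h) (h3 : 0 < b + k) (h4 : 0 < b + k + h) (hh : h ≠ 0) (hk : k ≠ 0) (ht : 0 < t) :
    (b + t + k + h) ^ c - (b + t + k) ^ c - (b + t + h) ^ c + (b + t) ^ c
      ≠ ((b + k + h) ^ c - (b + k) ^ c - (b + h) ^ c + b ^ c) := by
  intro h0
  rcases lt_or_gt_of_ne hh with hh | hh <;> rcases lt_or_gt_of_ne hk with hk | hk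
  · have := tb_W2 c hc (b + k + h) (-h) (-k) t h4 (by linarith) (by linarith) ht
    rw [show b + k + h + t + -k + -h = b + t by ring, show b + k + h + t + -k = b + t + h by ring,
      show b + k + h + t + -h = b + t + k by ring, show b + k + h + -k + -h = b by ring,
      show b + k + h + -k = b + h by ring, show b + k + h + -h = b + k by ring,
      show b + k + h + t = b + t + k + h by ring] at this
    linarith
  · have := tb_W2 c hc (b + h) (-h) k t h2 (by linarith) (by linarith) ht
    rw [show b + h + t + k + -h = b + t + k by ring, show b + h + t + k = b + t + k + h by ring,
      show b + h + t + -h = b + t by ring, show b + h + k + -h = b + k by ring,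
      show b + h + k = b + k + h by ring, show b + h + -h = b by ring,
      show b + h + t = b + t + h by ring] at this
    linarith
  · have := tb_W2 c hc (b + k) h (-k) t h3 (by linarith) (by linarith) ht
    rw [show b + k + t + -k + h = b + t + h by ring, show b + k + t + -k = b + t by ring,
      show b + k + t + h = b + t + k + h by ring, show b + k + -k + h = b + h by ring,
      show b + k + -k = b by ring, 
      show b + k + t = b + t + k by ring] at this
    linarith
  · have := tb_W2 c hc b h k t h1 (by linarith) (by linarith) ht
    linarith

theorem tb_inj2 (c : ℕ) (hc : c = 5 ∨ c = 6 ∨ c = 7) (p q p' q' : ℤ × ℤ)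
    (hp1 : 0 < p.1) (hp2 : 0 < p.2) (hq1 : 0 < q.1) (hq2 : 0 < q.2)
    (hp1' : 0 < p'.1) (hp2' : 0 < p'.2) (hq1' : 0 < q'.1) (hq2' : 0 < q'.2)
    (h : p.1 - p.2 = q.1 - q.2) (h' : p'.1 - p'.2 = q'.1 - q'.2) (hh : p.1 ≠ p.2) (hk : p.2 ≠ q.2)
    (e1 : p.1 - p.2 = p'.1 - p'.2) (e2 : p.2 - q.2 = p'.2 - q'.2)
    (ev : p.1 ^ c - p.2 ^ c - (q.1 ^ c - q.2 ^ c) = p'.1 ^ c - p'.2 ^ c - (q'.1 ^ c - q'.2 ^ c)) :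
    (p, q) = (p', q') := by
  have key : q.2 = q'.2 := by
    by_contra hne
    rcases lt_or_gt_of_ne hne with hl | hl
    · have := tb_inj2_aux c hc q.2 (p.1 - p.2) (p.2 - q.2) (q'.2 - q.2) hq2 (by linarith)
        (by linarith) (by linarith) (sub_ne_zero.mpr hh) (sub_ne_zero.mpr hk) (by linarith)
      apply this
      rw [show q.2 + (q'.2 - q.2) + (p.2 - q.2) + (p.1 - p.2) = p'.1 by linarith,
        show q.2 + (q'.2 - q.2) + (p.2 - q.2) = p'.2 by linarith,
        show q.2 + (q'.2 - q.2) + (p.1 - p.2) = q'.1 by linarith,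
        show q.2 + (q'.2 - q.2) = q'.2 by linarith,
        show q.2 + (p.2 - q.2) + (p.1 - p.2) = p.1 by linarith,
        show q.2 + (p.2 - q.2) = p.2 by linarith,
        show q.2 + (p.1 - p.2) = q.1 by linarith]
      linarith
    · have := tb_inj2_aux c hc q'.2 (p.1 - p.2) (p.2 - q.2) (q.2 - q'.2) hq2' (by linarith)
        (by linarith) (by linarith) (sub_ne_zero.mpr hh) (sub_ne_zero.mpr hk) (by linarith)
      apply this
      rw [show q'.2 + (q.2 - q'.2) + (p.2 - q.2) + (p.1 - p.2) = p.1 by linarith,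
        show q'.2 + (q.2 - q'.2) + (p.2 - q.2) = p.2 by linarith,
        show q'.2 + (q.2 - q'.2) + (p.1 - p.2) = q.1 by linarith,
        show q'.2 + (q.2 - q'.2) = q.2 by linarith,
        show q'.2 + (p.2 - q.2) + (p.1 - p.2) = p'.1 by linarith,
        show q'.2 + (p.2 - q.2) = p'.2 by linarith,
        show q'.2 + (p.1 - p.2) = q'.1 by linarith]
      linarith
  ext <;> simp only <;> linarith

/-- pairs fibre -/
theorem tb_pair (U : Finset ℤ) (hU : ∀ u ∈ U, 0 < u) (m : ℤ) (hm : m ≠ 0) :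
    #((U ×ˢ U).filter (fun p => p.1 ^ 5 - p.2 ^ 5 = m)) ≤ 2 * #m.natAbs.divisors := by
  refine le_trans ?_ (tb_sdiv_card m)
  apply Finset.card_le_card_of_injOn (fun p => p.1 - p.2)
  · intro p hp
    simp only [Finset.coe_filter, Finset.mem_product, Set.mem_ofPred_eq] at hp
    refine tb_mem_sdiv hm ?_
    rw [← hp.2]
    exact sub_dvd_pow_sub_pow _ _ _
  · intro p hp q hq hpq
    simp only [Finset.coe_filter, Finset.mem_product, Set.mem_ofPred_eq] at hp hq hpq
    have key : p.2 = q.2 := by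
      by_contra hne
      refine tb_inj1 5 (by norm_num) p.1 p.2 q.1 q.2 (hU _ hp.1.1) (hU _ hp.1.2) (hU _ hq.1.1)
        (hU _ hq.1.2) hpq ?_ hne (hp.2.trans hq.2.symm)
      intro h
      apply hm
      rw [← hp.2, h, sub_self]
    ext
    · linarith
    · exact key

/-- quadruple fibre -/
theorem tb_quad (c : ℕ) (hc : c = 5 ∨ c = 6 ∨ c = 7) (U : Finset ℤ) (hU : ∀ u ∈ U, 0 < u) (m : ℤ) :
    #(((U ×ˢ U) ×ˢ (U ×ˢ U)).filter (fun τ => (τ.1.1 - τ.1.2 = τ.2.1 - τ.2.2 ∧ τ.1.1 ≠ τ.1.2 ∧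
      τ.1.2 ≠ τ.2.2) ∧ τ.1.1 ^ c - τ.1.2 ^ c - (τ.2.1 ^ c - τ.2.2 ^ c) = m)) ≤
      (2 * #m.natAbs.divisors) ^ 2 := by
  have hle : #(tb_sdiv m ×ˢ tb_sdiv m) ≤ (2 * #m.natAbs.divisors) ^ 2 := by
    rw [Finset.card_product, ← sq]
    exact Nat.pow_le_pow_left (tb_sdiv_card m) 2
  refine le_trans ?_ hle
  apply Finset.card_le_card_of_injOn (fun τ => (τ.1.1 - τ.1.2, τ.1.2 - τ.2.2))
  · rintro ⟨⟨a, b⟩, ⟨a', b'⟩⟩ hp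
    simp only [Finset.coe_filter, Finset.mem_product, Set.mem_ofPred_eq] at hp
    obtain ⟨⟨⟨ha, hb⟩, ha', hb'⟩, ⟨h1, h2, h3⟩, h4⟩ := hp
    have hm : m ≠ 0 := by
      rw [← h4]
      exact sub_ne_zero.mpr (tb_inj1 c hc a b a' b' (hU _ ha) (hU _ hb) (hU _ ha') (hU _ hb') h1 h2 h3)
    simp only [Finset.coe_product, Set.mem_prod, Finset.mem_coe]
    refine ⟨tb_mem_sdiv hm ?_, tb_mem_sdiv hm ?_⟩
    · rw [← h4]
      refine dvd_sub (sub_dvd_pow_sub_pow _ _ _) ?_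
      rw [h1]
      exact sub_dvd_pow_sub_pow _ _ _
    · rw [← h4, show a ^ c - b ^ c - (a' ^ c - b' ^ c) = (a ^ c - a' ^ c) - (b ^ c - b' ^ c) by ring]
      refine dvd_sub ?_ (sub_dvd_pow_sub_pow _ _ _)
      rw [show b - b' = a - a' by linarith]
      exact sub_dvd_pow_sub_pow _ _ _
  · rintro ⟨p, q⟩ hp ⟨p', q'⟩ hq hpq
    simp only [Finset.coe_filter, Finset.mem_product, Set.mem_ofPred_eq, Prod.mk.injEq] at hp hq hpq
    obtain ⟨⟨⟨ha, hb⟩, ha', hb'⟩, ⟨h1, h2, h3⟩, h4⟩ := hp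
    obtain ⟨⟨⟨Ha, Hb⟩, Ha', Hb'⟩, ⟨H1, H2, H3⟩, H4⟩ := hq
    exact tb_inj2 c hc p q p' q' (hU _ ha) (hU _ hb) (hU _ ha') (hU _ hb') (hU _ Ha) (hU _ Hb)
      (hU _ Ha') (hU _ Hb') h1 H1 h2 h3 hpq.1 hpq.2 (h4.trans H4.symm)

/-- solutions of `z1^5+z2^5=z3^5+z4^5`. -/
def tb_N (U : Finset ℤ) : Finset ((ℤ × ℤ) × (ℤ × ℤ)) :=
  ((U ×ˢ U) ×ˢ (U ×ˢ U)).filter (fun τ => τ.1.1 ^ 5 + τ.1.2 ^ 5 = τ.2.1 ^ 5 + τ.2.2 ^ 5)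

theorem tb_pow5 {a b : ℤ} (h : a ^ 5 = b ^ 5) : a = b :=
  (Odd.strictMono_pow (by decide : Odd 5)).injective h

theorem tb_N_card (U : Finset ℤ) (n D : ℕ) (hU : ∀ u ∈ U, 0 < u ∧ u ^ 5 ≤ n)
    (hD : ∀ m : ℤ, |m| ≤ 4 * n → #m.natAbs.divisors ≤ D) :
    #(tb_N U) ≤ #U ^ 2 * (2 * D + 1) := by
  have hsplit := Finset.card_filter_add_card_filter_not (s := tb_N U) (fun τ => τ.1.1 = τ.2.1)
  have h1 : #((tb_N U).filter (fun τ => τ.1.1 = τ.2.1)) ≤ #(U ×ˢ U) := by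
    apply Finset.card_le_card_of_injOn (fun τ => τ.1)
    · rintro ⟨⟨a, b⟩, ⟨a', b'⟩⟩ hp
      simp only [tb_N, Finset.coe_filter, Finset.mem_filter, Finset.mem_product,
        Set.mem_ofPred_eq] at hp
      simp only [Finset.coe_product, Set.mem_prod, Finset.mem_coe]
      exact hp.1.1.1
    · rintro ⟨⟨a, b⟩, ⟨a', b'⟩⟩ hp ⟨⟨A, B⟩, ⟨A', B'⟩⟩ hq hpq
      simp only [tb_N, Finset.coe_filter, Finset.mem_filter, Finset.mem_product,
        Set.mem_ofPred_eq, Prod.mk.injEq] at hp hq hpq ⊢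
      obtain ⟨⟨-, hp1⟩, rfl⟩ := hp
      obtain ⟨⟨-, hq1⟩, rfl⟩ := hq
      obtain ⟨rfl, rfl⟩ := hpq
      exact ⟨⟨rfl, rfl⟩, rfl, tb_pow5 (by linarith)⟩
  have h2 : #((tb_N U).filter (fun τ => ¬ τ.1.1 = τ.2.1)) ≤ (2 * D) * #(U ×ˢ U) := by
    apply Finset.card_le_mul_card_image_of_maps_to (f := fun τ => (τ.1.1, τ.2.1))
    · rintro ⟨⟨a, b⟩, ⟨a', b'⟩⟩ hp
      simp only [tb_N, Finset.mem_filter, Finset.mem_product] at hp ⊢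
      exact ⟨hp.1.1.1.1, hp.1.1.2.1⟩
    · rintro ⟨x, y⟩ hxy
      rw [Finset.mem_product] at hxy
      by_cases hne : x = y
      · rw [Finset.card_eq_zero.mpr]
        · exact Nat.zero_le _
        · rw [Finset.filter_eq_empty_iff]
          rintro ⟨⟨a, b⟩, ⟨a', b'⟩⟩ hp hq
          simp only [tb_N, Finset.mem_filter, Prod.mk.injEq] at hp hq
          exact hp.2 (by rw [hq.1, hq.2, hne])
      have hx := hU _ hxy.1
      have hy := hU _ hxy.2
      simp only at hx hy
      have hm : x ^ 5 - y ^ 5 ≠ 0 := fun h => hne (tb_pow5 (by linarith))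
      have hb := tb_pair U (fun u hu => (hU u hu).1) _ hm
      have hd := hD (x ^ 5 - y ^ 5) (by
        have := pow_pos hx.1 5
        have := pow_pos hy.1 5
        rw [abs_le]
        constructor <;> linarith)
      refine le_trans ?_ (hb.trans (Nat.mul_le_mul_left 2 hd))
      apply Finset.card_le_card_of_injOn (fun τ => (τ.2.2, τ.1.2))
      · rintro ⟨⟨a, b⟩, ⟨a', b'⟩⟩ hp
        simp only [tb_N, Finset.coe_filter, Finset.mem_filter, Finset.mem_product,
          Set.mem_ofPred_eq, Prod.mk.injEq] at hp ⊢
        obtain ⟨⟨⟨h3, h4⟩, -⟩, rfl, rfl⟩ := hp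
        exact ⟨⟨h3.2.2, h3.1.2⟩, by linarith⟩
      · rintro ⟨⟨a, b⟩, ⟨a', b'⟩⟩ hp ⟨⟨A, B⟩, ⟨A', B'⟩⟩ hq hpq
        simp only [Finset.coe_filter, Set.mem_ofPred_eq, Prod.mk.injEq] at hp hq hpq ⊢
        obtain ⟨-, rfl, rfl⟩ := hp
        obtain ⟨-, rfl, rfl⟩ := hq
        obtain ⟨rfl, rfl⟩ := hpq
        exact ⟨⟨rfl, rfl⟩, rfl, rfl⟩
  rw [Finset.card_product] at h1 h2
  nlinarith

/-- `z1^5+z2^5-z3^5-z4^5` -/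
def tb_g (τ : (ℤ × ℤ) × (ℤ × ℤ)) : ℤ := τ.1.1 ^ 5 + τ.1.2 ^ 5 - τ.2.1 ^ 5 - τ.2.2 ^ 5

theorem tb_abs4 {n a b c d : ℤ} (ha : 0 < a) (hb : 0 < b) (hc : 0 < c) (hd : 0 < d)
    (ha' : a ≤ n) (hb' : b ≤ n) (hc' : c ≤ n) (hd' : d ≤ n) : |a + b - c - d| ≤ 4 * n := by
  rw [abs_le]
  constructor <;> linarith

theorem tb_J (U : Finset ℤ) (n D : ℕ) (Z : ℤ) (hZ : 0 ≤ Z) (hU : ∀ u ∈ U, 0 < u ∧ u ≤ Z ∧ u ^ 5 ≤ n)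
    (hD : ∀ m : ℤ, |m| ≤ 4 * n → #m.natAbs.divisors ≤ D) :
    #((((U ×ˢ U) ×ˢ (U ×ˢ U)) ×ˢ ((U ×ˢ U) ×ˢ (U ×ˢ U))).filter (fun p => tb_g p.1 = tb_g p.2)) ≤
      (2 * Z + 1).toNat * (2 * (#U ^ 2 * #(tb_N U)) + (2 * D) ^ 2 * #U ^ 4) := by
  have h0 := tb_cs1 ((U ×ˢ U) ×ˢ (U ×ˢ U)) tb_g (fun τ => τ.1.1 - τ.2.1) (Finset.Icc (-Z) Z) (by
    rintro ⟨⟨a, b⟩, ⟨a', b'⟩⟩ hp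
    simp only [Finset.mem_product] at hp
    have h1 := hU _ hp.1.1
    have h2 := hU _ hp.2.1
    simp only [Finset.mem_Icc]
    constructor <;> linarith)
  rw [Int.card_Icc, show Z + 1 - -Z = 2 * Z + 1 by ring] at h0
  refine h0.trans (Nat.mul_le_mul_left _ ?_)
  set X := (((U ×ˢ U) ×ˢ (U ×ˢ U)) ×ˢ ((U ×ˢ U) ×ˢ (U ×ˢ U))).filter
    (fun p => tb_g p.1 = tb_g p.2 ∧ p.1.1.1 - p.1.2.1 = p.2.1.1 - p.2.2.1) with hX0
  have hX : ∀ p, p ∈ X ↔ p ∈ ((U ×ˢ U) ×ˢ (U ×ˢ U)) ×ˢ ((U ×ˢ U) ×ˢ (U ×ˢ U)) ∧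
      tb_g p.1 = tb_g p.2 ∧ p.1.1.1 - p.1.2.1 = p.2.1.1 - p.2.2.1 := fun p => by
    rw [hX0, Finset.mem_filter]
  clear_value X
  have s1 := Finset.card_filter_add_card_filter_not (s := X) (fun p => p.1.1.1 = p.1.2.1)
  have s2 := Finset.card_filter_add_card_filter_not
    (s := X.filter (fun p => ¬ p.1.1.1 = p.1.2.1)) (fun p => p.1.2.1 = p.2.2.1)
  have b1 : #(X.filter (fun p => p.1.1.1 = p.1.2.1)) ≤ #((U ×ˢ U) ×ˢ tb_N U) := by
    apply Finset.card_le_card_of_injOn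
      (fun p => ((p.1.1.1, p.2.1.1), ((p.1.1.2, p.2.2.2), (p.2.1.2, p.1.2.2))))
    · rintro ⟨⟨⟨a, b⟩, ⟨c, d⟩⟩, ⟨⟨a', b'⟩, ⟨c', d'⟩⟩⟩ hp
      simp only [hX, tb_g, tb_N, Finset.coe_filter, Finset.mem_filter, Finset.mem_product,
        Set.mem_ofPred_eq, Finset.coe_product, Set.mem_prod, Finset.mem_coe] at hp ⊢
      obtain ⟨⟨⟨⟨⟨h1, h2⟩, h3, h4⟩, ⟨h1', h2'⟩, h3', h4'⟩, h5, h6⟩, rfl⟩ := hp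
      have h7 : a' = c' := by linarith
      subst h7
      exact ⟨⟨h1, h1'⟩, ⟨⟨h2, h4'⟩, h2', h4⟩, by linarith⟩
    · rintro ⟨⟨⟨a, b⟩, ⟨c, d⟩⟩, ⟨⟨a', b'⟩, ⟨c', d'⟩⟩⟩ hp ⟨⟨⟨A, B⟩, ⟨C, D⟩⟩, ⟨⟨A', B'⟩, ⟨C', D'⟩⟩⟩ hq hpq
      simp only [hX, tb_g, tb_N, Finset.coe_filter, Finset.mem_filter, 
        Set.mem_ofPred_eq, Prod.mk.injEq] at hp hq hpq ⊢
      obtain ⟨⟨-, -, h6⟩, h7⟩ := hp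
      obtain ⟨⟨-, -, H6⟩, H7⟩ := hq
      omega
  have b2 : #((X.filter (fun p => ¬ p.1.1.1 = p.1.2.1)).filter (fun p => p.1.2.1 = p.2.2.1))
      ≤ #((U ×ˢ U) ×ˢ tb_N U) := by
    apply Finset.card_le_card_of_injOn
      (fun p => ((p.1.1.1, p.1.2.1), ((p.1.1.2, p.2.2.2), (p.2.1.2, p.1.2.2))))
    · rintro ⟨⟨⟨a, b⟩, ⟨c, d⟩⟩, ⟨⟨a', b'⟩, ⟨c', d'⟩⟩⟩ hp
      simp only [hX, tb_g, tb_N, Finset.coe_filter, Finset.mem_filter, Finset.mem_product,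
        Set.mem_ofPred_eq, Finset.coe_product, Set.mem_prod, Finset.mem_coe] at hp ⊢
      obtain ⟨⟨⟨⟨⟨⟨h1, h2⟩, h3, h4⟩, ⟨h1', h2'⟩, h3', h4'⟩, h5, h6⟩, -⟩, rfl⟩ := hp
      have h7 : a = a' := by linarith
      subst h7
      exact ⟨⟨h1, h3⟩, ⟨⟨h2, h4'⟩, h2', h4⟩, by linarith⟩
    · rintro ⟨⟨⟨a, b⟩, ⟨c, d⟩⟩, ⟨⟨a', b'⟩, ⟨c', d'⟩⟩⟩ hp ⟨⟨⟨A, B⟩, ⟨C, D⟩⟩, ⟨⟨A', B'⟩, ⟨C', D'⟩⟩⟩ hq hpq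
      simp only [hX, tb_g, tb_N, Finset.coe_filter, Finset.mem_filter, 
        Set.mem_ofPred_eq, Prod.mk.injEq] at hp hq hpq ⊢
      obtain ⟨⟨⟨-, -, h6⟩, -⟩, h7⟩ := hp
      obtain ⟨⟨⟨-, -, H6⟩, -⟩, H7⟩ := hq
      omega
  have b3 : #((X.filter (fun p => ¬ p.1.1.1 = p.1.2.1)).filter (fun p => ¬ p.1.2.1 = p.2.2.1))
      ≤ (2 * D) ^ 2 * #((U ×ˢ U) ×ˢ (U ×ˢ U)) := by
    apply Finset.card_le_mul_card_image_of_maps_to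
      (f := fun p => ((p.2.1.2, p.1.2.2), (p.1.1.2, p.2.2.2)))
    · rintro ⟨⟨⟨a, b⟩, ⟨c, d⟩⟩, ⟨⟨a', b'⟩, ⟨c', d'⟩⟩⟩ hp
      simp only [hX, Finset.mem_filter, Finset.mem_product] at hp ⊢
      obtain ⟨⟨⟨⟨⟨⟨h1, h2⟩, h3, h4⟩, ⟨h1', h2'⟩, h3', h4'⟩, h5, h6⟩, -⟩, -⟩ := hp
      exact ⟨⟨h2', h4⟩, h2, h4'⟩
    · rintro ⟨⟨x, y⟩, ⟨z, w⟩⟩ hxy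
      simp only [Finset.mem_product] at hxy
      obtain ⟨⟨hx, hy⟩, hz, hw⟩ := hxy
      have hx := hU _ hx
      have hy := hU _ hy
      have hz := hU _ hz
      have hw := hU _ hw
      have hb := tb_quad 5 (by norm_num) U (fun u hu => (hU u hu).1) (x ^ 5 + y ^ 5 - z ^ 5 - w ^ 5)
      have hd := hD (x ^ 5 + y ^ 5 - z ^ 5 - w ^ 5)
        (tb_abs4 (pow_pos hx.1 5) (pow_pos hy.1 5) (pow_pos hz.1 5) (pow_pos hw.1 5)
          hx.2.2 hy.2.2 hz.2.2 hw.2.2)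
      refine le_trans ?_ (hb.trans (Nat.pow_le_pow_left (Nat.mul_le_mul_left 2 hd) 2))
      apply Finset.card_le_card_of_injOn (fun p => ((p.1.1.1, p.1.2.1), (p.2.1.1, p.2.2.1)))
      · rintro ⟨⟨⟨a, b⟩, ⟨c, d⟩⟩, ⟨⟨a', b'⟩, ⟨c', d'⟩⟩⟩ hp
        simp only [hX, tb_g, Finset.coe_filter, Finset.mem_filter, Finset.mem_product,
          Set.mem_ofPred_eq, Prod.mk.injEq] at hp ⊢
        obtain ⟨⟨⟨⟨⟨⟨⟨h1, h2⟩, h3, h4⟩, ⟨h1', h2'⟩, h3', h4'⟩, h5, h6⟩, h7⟩, h8⟩, ⟨rfl, rfl⟩, rfl, rfl⟩ := hp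
        exact ⟨⟨⟨h1, h3⟩, h1', h3'⟩, ⟨h6, h7, h8⟩, by linarith⟩
      · rintro ⟨⟨⟨a, b⟩, ⟨c, d⟩⟩, ⟨⟨a', b'⟩, ⟨c', d'⟩⟩⟩ hp ⟨⟨⟨A, B⟩, ⟨C, D⟩⟩, ⟨⟨A', B'⟩, ⟨C', D'⟩⟩⟩ hq hpq
        simp only [Finset.coe_filter, Set.mem_ofPred_eq, Prod.mk.injEq] at hp hq hpq ⊢
        obtain ⟨-, h7⟩ := hp
        obtain ⟨-, H7⟩ := hq
        omega
  simp only [Finset.card_product] at b1 b2 b3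
  rw [show #U * #U * (#U * #U) = #U ^ 4 by ring] at b3
  rw [show #U * #U * #(tb_N U) = #U ^ 2 * #(tb_N U) by ring] at b1 b2
  linarith

def tb_V (c : ℕ) (τ : (ℤ × ℤ) × (ℤ × ℤ)) : ℤ := τ.1.1 ^ c - τ.1.2 ^ c - (τ.2.1 ^ c - τ.2.2 ^ c)

/-- pairs of pairs of `y`s with equal, bounded, nonzero difference -/
noncomputable def tb_Q (G : Finset ℤ) (H : ℤ) : Finset ((ℤ × ℤ) × (ℤ × ℤ)) :=
  ((G ×ˢ G) ×ˢ (G ×ˢ G)).filter (fun τ => (τ.1.1 - τ.1.2 = τ.2.1 - τ.2.2 ∧ τ.1.1 ≠ τ.1.2 ∧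
      τ.1.2 ≠ τ.2.2) ∧ τ.1.1 - τ.1.2 ∈ Finset.Icc (-H) H)

theorem tb_Q_card (G : Finset ℤ) (H : ℤ) : #(tb_Q G H) ≤ #(Finset.Icc (-H) H) * #G ^ 2 := by
  rw [sq, ← Finset.card_product, ← Finset.card_product]
  apply Finset.card_le_card_of_injOn (fun τ => (τ.1.1 - τ.1.2, (τ.1.2, τ.2.2)))
  · rintro ⟨⟨a, b⟩, ⟨a', b'⟩⟩ hp
    simp only [tb_Q, Finset.coe_filter, Finset.mem_product, Set.mem_ofPred_eq, Finset.coe_product,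
      Set.mem_prod, Finset.mem_coe] at hp ⊢
    exact ⟨hp.2.2, hp.1.1.2, hp.1.2.2⟩
  · rintro ⟨⟨a, b⟩, ⟨a', b'⟩⟩ hp ⟨⟨A, B⟩, ⟨A', B'⟩⟩ hq hpq
    simp only [tb_Q, Finset.coe_filter, Set.mem_ofPred_eq, Prod.mk.injEq] at hp hq hpq ⊢
    obtain ⟨-, ⟨h1, -⟩, -⟩ := hp
    obtain ⟨-, ⟨h2, -⟩, -⟩ := hq
    omega

theorem tb_QQ (c : ℕ) (hc : c = 5 ∨ c = 6 ∨ c = 7) (G : Finset ℤ) (H : ℤ) (n D : ℕ)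
    (hG : ∀ u ∈ G, 0 < u ∧ u ^ c ≤ n)
    (hD : ∀ m : ℤ, |m| ≤ 4 * n → #m.natAbs.divisors ≤ D) :
    #((tb_Q G H ×ˢ tb_Q G H).filter (fun p => tb_V c p.1 = tb_V c p.2)) ≤
      (2 * D) ^ 2 * #(tb_Q G H) := by
  apply Finset.card_le_mul_card_image_of_maps_to (f := fun p => p.1)
  · intro p hp
    simp only [Finset.mem_filter, Finset.mem_product] at hp
    exact hp.1.1
  · intro σ hσ
    have hb := tb_quad c hc G (fun u hu => (hG u hu).1) (tb_V c σ)
    have hd := hD (tb_V c σ) (by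
      simp only [tb_Q, Finset.mem_filter, Finset.mem_product] at hσ
      obtain ⟨⟨⟨h1, h2⟩, h3, h4⟩, -⟩ := hσ
      have h1 := hG _ h1
      have h2 := hG _ h2
      have h3 := hG _ h3
      have h4 := hG _ h4
      have := tb_abs4 (pow_pos h1.1 c) (pow_pos h4.1 c) (pow_pos h2.1 c) (pow_pos h3.1 c)
        h1.2 h4.2 h2.2 h3.2
      convert this using 2
      unfold tb_V
      ring)
    refine le_trans ?_ (hb.trans (Nat.pow_le_pow_left (Nat.mul_le_mul_left 2 hd) 2))
    apply Finset.card_le_card_of_injOn (fun p => p.2)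
    · rintro ⟨p, q⟩ hp
      simp only [tb_Q, Finset.coe_filter, Finset.mem_filter, Finset.mem_product,
        Set.mem_ofPred_eq] at hp ⊢
      obtain ⟨⟨⟨-, h1, h2, -⟩, h3⟩, rfl⟩ := hp
      exact ⟨h1, h2, h3.symm⟩
    · rintro ⟨p, q⟩ hp ⟨p', q'⟩ hq hpq
      simp only [Finset.coe_filter, Set.mem_ofPred_eq] at hp hq hpq
      obtain ⟨-, rfl⟩ := hp
      obtain ⟨-, rfl⟩ := hq
      rw [hpq]

theorem tb_main (c : ℕ) (hc : c = 5 ∨ c = 6 ∨ c = 7) (G U : Finset ℤ) (H : ℤ) (n D : ℕ)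
    (hG : ∀ u ∈ G, 0 < u ∧ u ^ c ≤ n)
    (hD : ∀ m : ℤ, |m| ≤ 4 * n → #m.natAbs.divisors ≤ D)
    (hH : ∀ τ ∈ (G ×ˢ G) ×ˢ ((U ×ˢ U) ×ˢ (U ×ˢ U)), τ.1.1 ^ c - τ.1.2 ^ c = tb_g τ.2 →
      τ.1.1 - τ.1.2 ∈ Finset.Icc (-H) H) :
    ∃ T1 T2 : ℕ,
    #(((G ×ˢ G) ×ˢ ((U ×ˢ U) ×ˢ (U ×ˢ U))).filter (fun τ => τ.1.1 ^ c - τ.1.2 ^ c = tb_g τ.2)) ≤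
      #G * #(tb_N U) + T1 ∧
    T1 ^ 2 ≤ #(tb_N U) * (#(Finset.Icc (-H) H) * (#(Finset.Icc (-H) H) * #G * #(tb_N U) + T2)) ∧
    T2 ^ 2 ≤ ((2 * D) ^ 2 * (#(Finset.Icc (-H) H) * #G ^ 2)) *
      #((((U ×ˢ U) ×ˢ (U ×ˢ U)) ×ˢ ((U ×ˢ U) ×ˢ (U ×ˢ U))).filter
        (fun p => tb_g p.1 = tb_g p.2)) := by
  set K := Finset.Icc (-H) H with hK
  clear_value K
  set Y2 : Finset (ℤ × ℤ) := (G ×ˢ G).filter (fun y => y.1 ≠ y.2 ∧ y.1 - y.2 ∈ K) with hY2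
  have mY2 : ∀ y, y ∈ Y2 ↔ y ∈ G ×ˢ G ∧ y.1 ≠ y.2 ∧ y.1 - y.2 ∈ K := fun y => by
    rw [hY2, Finset.mem_filter]
  clear_value Y2
  let fz : ℤ × ℤ → ℤ := fun z => z.1 ^ 5 + z.2 ^ 5
  let gb : (ℤ × ℤ) × (ℤ × ℤ) → ℤ := fun b => b.1.1 ^ c - b.1.2 ^ c + (b.2.1 ^ 5 + b.2.2 ^ 5)
  refine ⟨#(((U ×ˢ U) ×ˢ (Y2 ×ˢ (U ×ˢ U))).filter (fun p => fz p.1 = gb p.2)),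
    #((tb_Q G H ×ˢ ((U ×ˢ U) ×ˢ (U ×ˢ U))).filter (fun p => tb_V c p.1 = tb_g p.2)), ?_, ?_, ?_⟩
  · set X := ((G ×ˢ G) ×ˢ ((U ×ˢ U) ×ˢ (U ×ˢ U))).filter
      (fun τ => τ.1.1 ^ c - τ.1.2 ^ c = tb_g τ.2) with hX0
    have hX : ∀ τ, τ ∈ X ↔ τ ∈ (G ×ˢ G) ×ˢ ((U ×ˢ U) ×ˢ (U ×ˢ U)) ∧
        τ.1.1 ^ c - τ.1.2 ^ c = tb_g τ.2 := fun p => by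
      rw [hX0, Finset.mem_filter]
    clear_value X
    rw [← Finset.card_filter_add_card_filter_not (s := X) (fun τ => τ.1.1 = τ.1.2)]
    refine add_le_add ?_ ?_
    · rw [← Finset.card_product]
      apply Finset.card_le_card_of_injOn (fun τ => (τ.1.1, τ.2))
      · rintro ⟨⟨y, y'⟩, ⟨⟨a, b⟩, ⟨a', b'⟩⟩⟩ hp
        simp only [hX, tb_g, tb_N, Finset.coe_filter, Finset.mem_filter, Finset.mem_product,
          Set.mem_ofPred_eq, Finset.coe_product, Set.mem_prod, Finset.mem_coe] at hp ⊢
        obtain ⟨⟨⟨⟨h1, h2⟩, h3⟩, h4⟩, rfl⟩ := hp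
        exact ⟨h1, h3, by linarith⟩
      · rintro ⟨⟨y, y'⟩, z⟩ hp ⟨⟨w, w'⟩, z'⟩ hq hpq
        simp only [Finset.coe_filter, Set.mem_ofPred_eq, Prod.mk.injEq] at hp hq hpq ⊢
        obtain ⟨-, rfl⟩ := hp
        obtain ⟨-, rfl⟩ := hq
        exact ⟨⟨hpq.1, hpq.1⟩, hpq.2⟩
    · apply Finset.card_le_card_of_injOn (fun τ => (τ.2.1, (τ.1, τ.2.2)))
      · rintro ⟨⟨y, y'⟩, ⟨⟨a, b⟩, ⟨a', b'⟩⟩⟩ hp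
        simp only [hX, Finset.coe_filter, Set.mem_ofPred_eq] at hp
        obtain ⟨⟨h1, h2⟩, h3⟩ := hp
        have h4 := hH _ h1 h2
        simp only [tb_g, Finset.mem_product] at h1 h2 h4
        simp only [fz, gb, Finset.coe_filter, Finset.mem_product, mY2, Set.mem_ofPred_eq]
        obtain ⟨h5, h6, h7⟩ := h1
        exact ⟨⟨h6, ⟨h5, h3, h4⟩, h7⟩, by linarith⟩
      · rintro ⟨y, z, w⟩ hp ⟨y', z', w'⟩ hq hpq
        simp only [Prod.mk.injEq] at hpq ⊢
        tauto
  · refine (tb_cs0 (U ×ˢ U) (Y2 ×ˢ (U ×ˢ U)) fz gb).trans ?_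
    refine Nat.mul_le_mul (le_of_eq rfl) ?_
    refine (tb_cs1 (Y2 ×ˢ (U ×ˢ U)) gb (fun b => b.1.1 - b.1.2) K (fun b hb => by
      rw [Finset.mem_product, mY2] at hb
      exact hb.1.2.2)).trans (Nat.mul_le_mul_left _ ?_)
    set X := ((Y2 ×ˢ (U ×ˢ U)) ×ˢ (Y2 ×ˢ (U ×ˢ U))).filter
      (fun p => gb p.1 = gb p.2 ∧ p.1.1.1 - p.1.1.2 = p.2.1.1 - p.2.1.2) with hX0
    have hX : ∀ p, p ∈ X ↔ p ∈ (Y2 ×ˢ (U ×ˢ U)) ×ˢ (Y2 ×ˢ (U ×ˢ U)) ∧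
        (gb p.1 = gb p.2 ∧ p.1.1.1 - p.1.1.2 = p.2.1.1 - p.2.1.2) := fun p => by
      rw [hX0, Finset.mem_filter]
    clear_value X
    rw [← Finset.card_filter_add_card_filter_not (s := X) (fun p => p.1.1.2 = p.2.1.2)]
    refine add_le_add ?_ ?_
    · rw [← Finset.card_product, ← Finset.card_product]
      apply Finset.card_le_card_of_injOn (fun p => ((p.1.1.1 - p.1.1.2, p.1.1.2), (p.1.2, p.2.2)))
      · rintro ⟨⟨⟨y, y'⟩, z⟩, ⟨⟨w, w'⟩, z'⟩⟩ hp
        simp only [hX, gb, mY2, tb_N, Finset.coe_filter, Finset.mem_filter, Finset.mem_product,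
          Set.mem_ofPred_eq, Finset.coe_product, Set.mem_prod, Finset.mem_coe] at hp ⊢
        obtain ⟨⟨⟨⟨⟨h1, h2, h3⟩, h4⟩, h5, h6⟩, h7, h8⟩, rfl⟩ := hp
        have h9 : y = w := by linarith
        subst h9
        exact ⟨⟨h3, h1.2⟩, ⟨h4, h6⟩, by linarith⟩
      · rintro ⟨⟨⟨y, y'⟩, z⟩, ⟨⟨w, w'⟩, z'⟩⟩ hp ⟨⟨⟨Y, Y'⟩, Z⟩, ⟨⟨W, W'⟩, Z'⟩⟩ hq hpq
        simp only [hX, Finset.coe_filter, Set.mem_ofPred_eq, Prod.mk.injEq] at hp hq hpq ⊢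
        obtain ⟨⟨-, -, h1⟩, h2⟩ := hp
        obtain ⟨⟨-, -, h3⟩, h4⟩ := hq
        obtain ⟨⟨h5, h6⟩, rfl, rfl⟩ := hpq
        refine ⟨⟨⟨?_, ?_⟩, rfl⟩, ⟨⟨?_, ?_⟩, rfl⟩⟩ <;> linarith
    · apply Finset.card_le_card_of_injOn (fun p => ((p.1.1, p.2.1), (p.2.2, p.1.2)))
      · rintro ⟨⟨⟨y, y'⟩, z⟩, ⟨⟨w, w'⟩, z'⟩⟩ hp
        simp only [hX, gb, mY2, tb_V, tb_g, tb_Q, Finset.coe_filter, Finset.mem_filter,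
          Finset.mem_product, Set.mem_ofPred_eq, ← hK] at hp ⊢
        obtain ⟨⟨⟨⟨⟨h1, h2, h3⟩, h4⟩, ⟨h5, h5', h5''⟩, h6⟩, h7, h8⟩, h9⟩ := hp
        exact ⟨⟨⟨⟨h1, h5⟩, ⟨h8, h2, h9⟩, h3⟩, h6, h4⟩, by linarith⟩
      · rintro ⟨⟨y, z⟩, ⟨w, z'⟩⟩ hp ⟨⟨Y, Z⟩, ⟨W, Z'⟩⟩ hq hpq
        simp only [Prod.mk.injEq] at hpq ⊢
        tauto
  · refine (tb_cs0 (tb_Q G H) ((U ×ˢ U) ×ˢ (U ×ˢ U)) (tb_V c) tb_g).trans ?_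
    refine Nat.mul_le_mul_right _ ((tb_QQ c hc G H n D hG hD).trans (Nat.mul_le_mul_left _ ?_))
    rw [hK]
    exact tb_Q_card G H

theorem tb_arith (N g K J T1 T2 S u D Y Z k : ℝ) (hN0 : 0 ≤ N) (hg0 : 0 ≤ g) (hK0 : 0 ≤ K)
    (hJ0 : 0 ≤ J) (hT1 : 0 ≤ T1) (hT2 : 0 ≤ T2) (hu0 : 0 ≤ u) (hD : 1 ≤ D) (hY : 1 ≤ Y) (hZ : 1 ≤ Z)
    (hk : 1 ≤ k) (hN : N ≤ u ^ 2 * (2 * D + 1)) (hg : g ≤ Y) (hu : u ≤ Z) (hK : K ≤ 257 * k)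
    (hJ : J ≤ (3 * Z) * (2 * (u ^ 2 * N) + (2 * D) ^ 2 * u ^ 4))
    (hS : S ≤ g * N + T1) (h1 : T1 ^ 2 ≤ N * (K * (K * g * N + T2)))
    (h2 : T2 ^ 2 ≤ ((2 * D) ^ 2 * (K * g ^ 2)) * J)
    (hk1 : k ^ 2 ≤ Y) (hk2 : k ^ 3 * Z ≤ Y ^ 2) : S ≤ 1003 * D ^ 2 * Y * Z ^ 2 := by
  have hN' : N ≤ 3 * D * Z ^ 2 := by
    calc N ≤ u ^ 2 * (2 * D + 1) := hN
      _ ≤ Z ^ 2 * (3 * D) := by gcongr; linarith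
      _ = _ := by ring
  have hJ' : J ≤ 30 * D ^ 2 * Z ^ 5 := by
    calc J ≤ (3 * Z) * (2 * (u ^ 2 * N) + (2 * D) ^ 2 * u ^ 4) := hJ
      _ ≤ (3 * Z) * (2 * (Z ^ 2 * (3 * D * Z ^ 2)) + (2 * D) ^ 2 * Z ^ 4) := by gcongr
      _ = 12 * D ^ 2 * Z ^ 5 + 18 * Z ^ 5 * (D * 1) := by ring
      _ ≤ 12 * D ^ 2 * Z ^ 5 + 18 * Z ^ 5 * (D * D) := by gcongr
      _ = _ := by ring
  have hT2' : k * T2 ≤ 176 * D ^ 2 * Y ^ 2 * Z ^ 2 := by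
    refine (pow_le_pow_iff_left₀ (by positivity) (by positivity) two_ne_zero).mp ?_
    calc (k * T2) ^ 2 = k ^ 2 * T2 ^ 2 := by ring
      _ ≤ k ^ 2 * (((2 * D) ^ 2 * (K * g ^ 2)) * J) := by gcongr
      _ ≤ k ^ 2 * (((2 * D) ^ 2 * ((257 * k) * Y ^ 2)) * (30 * D ^ 2 * Z ^ 5)) := by gcongr
      _ = 30840 * D ^ 4 * Y ^ 2 * Z ^ 4 * (k ^ 3 * Z) := by ring
      _ ≤ 30840 * D ^ 4 * Y ^ 2 * Z ^ 4 * Y ^ 2 := by gcongr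
      _ ≤ 30976 * D ^ 4 * Y ^ 2 * Z ^ 4 * Y ^ 2 := by gcongr; norm_num
      _ = _ := by ring
  have hT1' : T1 ≤ 1000 * D ^ 2 * Y * Z ^ 2 := by
    refine (pow_le_pow_iff_left₀ (by positivity) (by positivity) two_ne_zero).mp ?_
    calc T1 ^ 2 ≤ N * (K * (K * g * N + T2)) := h1
      _ ≤ (3 * D * Z ^ 2) * ((257 * k) * ((257 * k) * Y * (3 * D * Z ^ 2) + T2)) := by gcongr
      _ = 594441 * D ^ 2 * Y * Z ^ 4 * k ^ 2 + 771 * D * Z ^ 2 * (k * T2) := by ring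
      _ ≤ 594441 * D ^ 2 * Y * Z ^ 4 * Y + 771 * D * Z ^ 2 * (176 * D ^ 2 * Y ^ 2 * Z ^ 2) := by gcongr
      _ = (594441 * D ^ 2 + 135696 * D ^ 3) * Y ^ 2 * Z ^ 4 := by ring
      _ ≤ (594441 * D ^ 4 + 135696 * D ^ 4) * Y ^ 2 * Z ^ 4 := by
          gcongr <;> first | exact hD | norm_num
      _ ≤ 1000000 * D ^ 4 * Y ^ 2 * Z ^ 4 := by
          gcongr
          nlinarith [pow_pos (lt_of_lt_of_le one_pos hD) 4]
      _ = _ := by ring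
  calc S ≤ g * N + T1 := hS
    _ ≤ Y * (3 * D * Z ^ 2) + 1000 * D ^ 2 * Y * Z ^ 2 := by gcongr
    _ = 3 * Y * Z ^ 2 * (D * 1) + 1000 * D ^ 2 * Y * Z ^ 2 := by ring
    _ ≤ 3 * Y * Z ^ 2 * (D * D) + 1000 * D ^ 2 * Y * Z ^ 2 := by gcongr
    _ = _ := by ring

/-- exponent facts -/
theorem tb_exps (c : ℕ) (hc : c = 6 ∨ c = 7) (n : ℕ) (hn : 1 ≤ n) :
    ∃ k : ℝ, 1 ≤ k ∧ 1 ≤ P n c ∧ 1 ≤ P n 5 ^ θ c ∧ P n c ^ c = n ∧ (P n 5 ^ θ c) ^ 5 ≤ n ∧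
      (P n 5 ^ θ c) ^ 5 ≤ P n c ^ (c - 1) * k ∧ k ^ 2 ≤ P n c ∧ k ^ 3 * P n 5 ^ θ c ≤ P n c ^ 2 := by
  have hn1 : (1 : ℝ) ≤ n := by exact_mod_cast hn
  have hn0 : (0 : ℝ) ≤ n := by linarith
  have hpos : (0 : ℝ) < n := by linarith
  have hpw : ∀ (x : ℝ) (m : ℕ), ((n : ℝ) ^ x) ^ m = (n : ℝ) ^ (x * m) := fun x m => by
    rw [← Real.rpow_natCast, ← Real.rpow_mul hn0]
  refine ⟨(n : ℝ) ^ ((c : ℝ)⁻¹ * (3 / 14)), ?_, ?_, ?_, ?_, ?_, ?_, ?_, ?_⟩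
  · exact Real.one_le_rpow hn1 (by positivity)
  · exact Real.one_le_rpow hn1 (by positivity)
  all_goals
    unfold P
    try rw [← Real.rpow_mul hn0]
    try simp only [hpw]
    try simp only [← Real.rpow_add hpos]
  · apply Real.one_le_rpow hn1
    unfold θ
    split_ifs <;> norm_num
  · rcases hc with rfl | rfl <;> norm_num
  · conv_rhs => rw [← Real.rpow_one (n : ℝ)]
    apply Real.rpow_le_rpow_of_exponent_le hn1
    rcases hc with rfl | rfl <;> norm_num [θ]
  all_goals
    apply Real.rpow_le_rpow_of_exponent_le hn1
    rcases hc with rfl | rfl <;> norm_num [θ]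

theorem tb_gap (c : ℕ) (hc : 1 ≤ c) (a b q W : ℝ) (hq : 0 ≤ q) (ha : q ≤ a) (hb : q ≤ b)
    (h : |a ^ c - b ^ c| ≤ W) : |a - b| * q ^ (c - 1) ≤ W := by
  obtain ⟨d, rfl⟩ : ∃ d, c = d + 1 := ⟨c - 1, by omega⟩
  simp only [Nat.add_sub_cancel]
  rw [abs_le] at h
  rcases le_total b a with hab | hab
  · rw [abs_of_nonneg (by linarith)]
    have h1 : b ^ d ≤ a ^ d := by gcongr; linarith
    have h2 : q ^ d ≤ b ^ d := by gcongr
    have h3 : (a - b) * q ^ d ≤ (a - b) * b ^ d := by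
      apply mul_le_mul_of_nonneg_left h2; linarith
    have h4 : a * b ^ d ≤ a * a ^ d := mul_le_mul_of_nonneg_left h1 (by linarith)
    have h5 := h.2
    rw [pow_succ, pow_succ] at h5
    linarith
  · rw [abs_of_nonpos (by linarith)]
    have h1 : a ^ d ≤ b ^ d := by gcongr; linarith
    have h2 : q ^ d ≤ a ^ d := by gcongr
    have h3 : (b - a) * q ^ d ≤ (b - a) * a ^ d := by
      apply mul_le_mul_of_nonneg_left h2; linarith
    have h4 : b * a ^ d ≤ b * b ^ d := mul_le_mul_of_nonneg_left h1 (by linarith)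
    have h5 := h.1
    rw [pow_succ, pow_succ] at h5
    linarith

theorem tb_count (c : ℕ) (hc : c = 6 ∨ c = 7) (n D : ℕ) (hn : 1 ≤ n) (hD1 : 1 ≤ D)
    (hD : ∀ m : ℤ, |m| ≤ 4 * n → #m.natAbs.divisors ≤ D) (G U : Finset ℤ)
    (hGdef : G = (Finset.Icc 1 ⌊P n c⌋).filter (fun y : ℤ => P n c / 2 < (y : ℝ)))
    (hUdef : U = Finset.Icc 1 ⌊P n 5 ^ θ c⌋) :
    (#(((G ×ˢ G) ×ˢ ((U ×ˢ U) ×ˢ (U ×ˢ U))).filter (fun τ => τ.1.1 ^ c - τ.1.2 ^ c = tb_g τ.2)) : ℝ)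
      ≤ 1003 * (D : ℝ) ^ 2 * P n c * (P n 5 ^ θ c) ^ 2 := by
  obtain ⟨k, hk, hY1, hZ1, hYc, hZ5, hZY, hk1, hk2⟩ := tb_exps c hc n hn
  set Y := P n c with hYd
  set Z := P n 5 ^ θ c with hZd
  clear_value Y Z
  have hc' : c = 5 ∨ c = 6 ∨ c = 7 := by omega
  have hG' : ∀ u ∈ G, 1 ≤ u ∧ (u : ℝ) ≤ Y ∧ Y / 2 ≤ u := fun u hu => by
    rw [hGdef, Finset.mem_filter, Finset.mem_Icc, Int.le_floor] at hu
    exact ⟨hu.1.1, hu.1.2, hu.2.le⟩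
  have hU' : ∀ u ∈ U, 1 ≤ u ∧ u ≤ ⌊Z⌋ ∧ (u : ℝ) ≤ Z := fun u hu => by
    rw [hUdef, Finset.mem_Icc] at hu
    exact ⟨hu.1, hu.2, Int.le_floor.mp hu.2⟩
  have hG : ∀ u ∈ G, 0 < u ∧ u ^ c ≤ (n : ℤ) := fun u hu => by
    obtain ⟨h1, h2, -⟩ := hG' u hu
    refine ⟨by omega, ?_⟩
    have h0 : (0 : ℝ) ≤ u := by exact_mod_cast (by omega : (0 : ℤ) ≤ u)
    have : (u : ℝ) ^ c ≤ n := by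
      rw [← hYc]
      gcongr
    exact_mod_cast this
  have hU : ∀ u ∈ U, 0 < u ∧ u ≤ ⌊Z⌋ ∧ u ^ 5 ≤ (n : ℤ) := fun u hu => by
    obtain ⟨h1, h2, h3⟩ := hU' u hu
    refine ⟨by omega, h2, ?_⟩
    have h0 : (0 : ℝ) ≤ u := by exact_mod_cast (by omega : (0 : ℤ) ≤ u)
    have : (u : ℝ) ^ 5 ≤ n := by
      refine le_trans ?_ hZ5
      gcongr
    exact_mod_cast this
  have hfl0 : 1 ≤ ⌊Z⌋ := Int.le_floor.mpr (by exact_mod_cast hZ1)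
  have hfl : (⌊Z⌋ : ℝ) ≤ Z := Int.floor_le Z
  have hH0 : 1 ≤ ⌊128 * k⌋ := Int.le_floor.mpr (by push_cast; linarith)
  have hHl : (⌊128 * k⌋ : ℝ) ≤ 128 * k := Int.floor_le _
  obtain ⟨T1, T2, e1, e2, e3⟩ := tb_main c hc' G U ⌊128 * k⌋ n D hG hD (by
    rintro ⟨⟨a, b⟩, ⟨⟨z1, z2⟩, ⟨z3, z4⟩⟩⟩ hp heq
    simp only [Finset.mem_product] at hp
    obtain ⟨⟨ha, hb⟩, ⟨hz1, hz2⟩, hz3, hz4⟩ := hp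
    have hz : ∀ u ∈ U, 0 ≤ (u : ℝ) ^ 5 ∧ (u : ℝ) ^ 5 ≤ Z ^ 5 := fun u hu => by
      obtain ⟨h1, h2, h3⟩ := hU' u hu
      have h0 : (0 : ℝ) ≤ u := by exact_mod_cast (by omega : (0 : ℤ) ≤ u)
      exact ⟨by positivity, by gcongr⟩
    have a1 := hz _ hz1
    have a2 := hz _ hz2
    have a3 := hz _ hz3
    have a4 := hz _ hz4
    simp only [tb_g] at heq
    have heq' : (a : ℝ) ^ c - (b : ℝ) ^ c = (z1 : ℝ) ^ 5 + (z2 : ℝ) ^ 5 - (z3 : ℝ) ^ 5 - (z4 : ℝ) ^ 5 := by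
      exact_mod_cast heq
    have hgap := tb_gap c (by omega) a b (Y / 2) (2 * Z ^ 5) (by linarith) (hG' a ha).2.2
      (hG' b hb).2.2 (by rw [heq', abs_le]; constructor <;> linarith)
    have hYp : 0 < Y ^ (c - 1) := by positivity
    have h2c : (2 : ℝ) ^ (c - 1) ≤ 64 := by rcases hc with rfl | rfl <;> norm_num
    have h3 : |(a : ℝ) - b| ≤ 128 * k := by
      rw [div_pow, ← mul_div_assoc, div_le_iff₀ (by positivity)] at hgap
      have : |(a : ℝ) - b| * Y ^ (c - 1) ≤ (128 * k) * Y ^ (c - 1) := by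
        calc _ ≤ 2 * Z ^ 5 * 2 ^ (c - 1) := hgap
          _ ≤ 2 * (Y ^ (c - 1) * k) * 64 := by gcongr
          _ = _ := by ring
      exact le_of_mul_le_mul_right this hYp
    rw [abs_le] at h3
    rw [Finset.mem_Icc]
    have h4 : a - b ≤ ⌊128 * k⌋ := Int.le_floor.mpr (by push_cast; linarith)
    have h5 : b - a ≤ ⌊128 * k⌋ := Int.le_floor.mpr (by push_cast; linarith)
    constructor <;> simp only <;> linarith)
  have e4 := tb_J U n D ⌊Z⌋ (by omega) hU hD
  have e5 := tb_N_card U n D (fun u hu => ⟨(hU u hu).1, (hU u hu).2.2⟩) hD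
  have cU : (#U : ℝ) ≤ Z := by
    have : #U = (⌊Z⌋).toNat := by rw [hUdef, Int.card_Icc]; congr 1; ring
    rw [this]
    refine le_trans (le_of_eq ?_) hfl
    exact_mod_cast Int.toNat_of_nonneg (by omega : 0 ≤ ⌊Z⌋)
  have cG : (#G : ℝ) ≤ Y := by
    have h1 : #G ≤ (⌊Y⌋).toNat := by
      rw [hGdef]
      refine (Finset.card_filter_le _ _).trans (le_of_eq ?_)
      rw [Int.card_Icc]; congr 1; ring
    have h2 : 0 ≤ ⌊Y⌋ := Int.floor_nonneg.mpr (by linarith)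
    have h3 : ((⌊Y⌋).toNat : ℝ) = (⌊Y⌋ : ℝ) := by exact_mod_cast Int.toNat_of_nonneg h2
    calc (#G : ℝ) ≤ ((⌊Y⌋).toNat : ℝ) := by exact_mod_cast h1
      _ ≤ Y := h3 ▸ Int.floor_le Y
  have cK : (#(Finset.Icc (-⌊128 * k⌋) ⌊128 * k⌋) : ℝ) ≤ 257 * k := by
    rw [Int.card_Icc]
    have h3 : (((⌊128 * k⌋ + 1 - -⌊128 * k⌋).toNat : ℕ) : ℝ) = ((⌊128 * k⌋ + 1 - -⌊128 * k⌋ : ℤ) : ℝ) := by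
      exact_mod_cast Int.toNat_of_nonneg (by omega)
    rw [h3]
    push_cast
    linarith
  have cZ : (((2 * ⌊Z⌋ + 1).toNat : ℕ) : ℝ) ≤ 3 * Z := by
    have h3 : (((2 * ⌊Z⌋ + 1).toNat : ℕ) : ℝ) = ((2 * ⌊Z⌋ + 1 : ℤ) : ℝ) := by
      exact_mod_cast Int.toNat_of_nonneg (by omega)
    rw [h3]
    push_cast
    linarith
  refine tb_arith (#(tb_N U)) (#G) (#(Finset.Icc (-⌊128 * k⌋) ⌊128 * k⌋)) _ T1 T2 _ (#U) D Y Z k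
    (by positivity) (by positivity) (by positivity) (Nat.cast_nonneg _) (by positivity)
    (by positivity) (by positivity) (by exact_mod_cast hD1) hY1 hZ1 hk (by exact_mod_cast e5)
    cG cU cK (le_trans (Nat.cast_le.mpr e4) ?_) (by exact_mod_cast e1) (by exact_mod_cast e2)
    (by exact_mod_cast e3) hk1 hk2
  push_cast
  gcongr

/-- The number `T_c` of solutions of `y1^c - y2^c = z1⁵ + z2⁵ - z3⁵ - z4⁵` with
`P_c/2 < yᵢ ≤ P_c` and `1 ≤ z_j ≤ P_5^{θ_c}` satisfies `T_c ≪ P_c^{1+ε} P_5^{2θ_c}`. -/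
theorem T_bound (c : ℕ) (hc : c = 6 ∨ c = 7) (ε : ℝ) (hε : 0 < ε) :
    ∃ C : ℝ, 0 < C ∧ ∃ N : ℕ, ∀ n : ℕ, N ≤ n →
      (Nat.card {t : ℕ × ℕ × ℕ × ℕ × ℕ × ℕ //
          (P n c / 2 < (t.1 : ℝ) ∧ (t.1 : ℝ) ≤ P n c) ∧
          (P n c / 2 < (t.2.1 : ℝ) ∧ (t.2.1 : ℝ) ≤ P n c) ∧
          (1 ≤ t.2.2.1 ∧ (t.2.2.1 : ℝ) ≤ P n 5 ^ θ c) ∧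
          (1 ≤ t.2.2.2.1 ∧ (t.2.2.2.1 : ℝ) ≤ P n 5 ^ θ c) ∧
          (1 ≤ t.2.2.2.2.1 ∧ (t.2.2.2.2.1 : ℝ) ≤ P n 5 ^ θ c) ∧
          (1 ≤ t.2.2.2.2.2 ∧ (t.2.2.2.2.2 : ℝ) ≤ P n 5 ^ θ c) ∧
          (t.1 : ℤ) ^ c - (t.2.1 : ℤ) ^ c =
            (t.2.2.1 : ℤ) ^ 5 + (t.2.2.2.1 : ℤ) ^ 5
              - (t.2.2.2.2.1 : ℤ) ^ 5 - (t.2.2.2.2.2 : ℤ) ^ 5} : ℝ) ≤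
        C * P n c ^ (1 + ε) * P n 5 ^ (2 * θ c) := by
  have hc0 : (0 : ℝ) < c := by rcases hc with rfl | rfl <;> norm_num
  set δ : ℝ := ε / c / 2 with hδ
  have hδ0 : 0 < δ := by positivity
  obtain ⟨C1, hC1, hdiv⟩ := tb_div δ hδ0
  refine ⟨1003 * (C1 * 4 ^ δ) ^ 2, by positivity, 1, fun n hn => ?_⟩
  have hn1 : (1 : ℝ) ≤ n := by exact_mod_cast hn
  set D : ℕ := ⌊C1 * (4 * n : ℝ) ^ δ⌋₊ with hDdef
  have hD1 : 1 ≤ D := by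
    apply Nat.le_floor
    have : (1 : ℝ) ≤ (4 * n : ℝ) ^ δ := Real.one_le_rpow (by linarith) hδ0.le
    push_cast
    nlinarith
  have hDle : (D : ℝ) ≤ C1 * (4 * n : ℝ) ^ δ := Nat.floor_le (by positivity)
  have hD : ∀ m : ℤ, |m| ≤ 4 * n → #m.natAbs.divisors ≤ D := by
    intro m hm
    by_cases h0 : m = 0
    · simp [h0]
    apply Nat.le_floor
    refine (hdiv m.natAbs (Int.natAbs_ne_zero.mpr h0)).trans ?_
    have : (m.natAbs : ℝ) ≤ 4 * n := by
      have h1 : m.natAbs ≤ 4 * n := by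
        rw [Int.abs_eq_natAbs] at hm
        omega
      exact_mod_cast h1
    gcongr
  have hcount := tb_count c hc n D hn hD1 hD _ _ rfl rfl
  obtain ⟨k, hk, hY1, hZ1, hYc, -, -, -, -⟩ := tb_exps c hc n hn
  set G := (Finset.Icc 1 ⌊P n c⌋).filter (fun y : ℤ => P n c / 2 < (y : ℝ)) with hGd
  set U := Finset.Icc 1 ⌊P n 5 ^ θ c⌋ with hUd
  set X := ((G ×ˢ G) ×ˢ ((U ×ˢ U) ×ˢ (U ×ˢ U))).filter
    (fun τ => τ.1.1 ^ c - τ.1.2 ^ c = tb_g τ.2) with hX0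
  have hX : ∀ τ, τ ∈ X ↔ τ ∈ (G ×ˢ G) ×ˢ ((U ×ˢ U) ×ˢ (U ×ˢ U)) ∧
        τ.1.1 ^ c - τ.1.2 ^ c = tb_g τ.2 := fun p => by
      rw [hX0, Finset.mem_filter]
  have hfin : (#X : ℝ) ≤ 1003 * (C1 * 4 ^ δ) ^ 2 * P n c ^ (1 + ε) * P n 5 ^ (2 * θ c) := by
    refine hcount.trans ?_
    have hD2 : (D : ℝ) ^ 2 ≤ (C1 * 4 ^ δ) ^ 2 * P n c ^ ε := by
      calc (D : ℝ) ^ 2 ≤ (C1 * (4 * n : ℝ) ^ δ) ^ 2 := by gcongr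
        _ = (C1 * 4 ^ δ) ^ 2 * ((n : ℝ) ^ δ) ^ 2 := by
            rw [Real.mul_rpow (by norm_num) (by linarith)]; ring
        _ = _ := by
            congr 1
            unfold P
            rw [← Real.rpow_natCast, ← Real.rpow_mul (by linarith), ← Real.rpow_mul (by linarith)]
            congr 1
            rw [hδ]
            push_cast
            field_simp
    have hP5 : P n 5 ^ (2 * θ c) = (P n 5 ^ θ c) ^ 2 := by
      rw [← Real.rpow_natCast, ← Real.rpow_mul (by unfold P; positivity)]
      congr 1
      push_cast
      ring
    rw [hP5, Real.rpow_add (by linarith), Real.rpow_one]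
    calc _ ≤ 1003 * ((C1 * 4 ^ δ) ^ 2 * P n c ^ ε) * P n c * (P n 5 ^ θ c) ^ 2 := by gcongr
      _ = _ := by ring
  refine le_trans ?_ hfin
  have hGm : ∀ y : ℕ, P n c / 2 < (y : ℝ) → (y : ℝ) ≤ P n c → (y : ℤ) ∈ G := fun y h1 h2 => by
    rw [hGd, Finset.mem_filter, Finset.mem_Icc, Int.le_floor]
    refine ⟨⟨?_, by exact_mod_cast h2⟩, by exact_mod_cast h1⟩
    have : (0 : ℝ) < y := by linarith
    have : 0 < y := by exact_mod_cast this
    omega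
  have hUm : ∀ z : ℕ, 1 ≤ z → (z : ℝ) ≤ P n 5 ^ θ c → (z : ℤ) ∈ U := fun z h1 h2 => by
    rw [hUd, Finset.mem_Icc, Int.le_floor]
    exact ⟨by omega, by exact_mod_cast h2⟩
  have hcard : #X = Nat.card X := by simp
  rw [hcard]
  refine Nat.cast_le.mpr (Nat.card_le_card_of_injective
    (fun t => (⟨(((t.1.1 : ℤ), (t.1.2.1 : ℤ)), (((t.1.2.2.1 : ℤ), (t.1.2.2.2.1 : ℤ)),
      ((t.1.2.2.2.2.1 : ℤ), (t.1.2.2.2.2.2 : ℤ)))), ?_⟩ : X)) ?_)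
  · obtain ⟨⟨y1, y2, z1, z2, z3, z4⟩, h1, h2, h3, h4, h5, h6, h7⟩ := t
    rw [hX]
    simp only [Finset.mem_product, tb_g]
    exact ⟨⟨⟨hGm _ h1.1 h1.2, hGm _ h2.1 h2.2⟩, ⟨hUm _ h3.1 h3.2, hUm _ h4.1 h4.2⟩,
      hUm _ h5.1 h5.2, hUm _ h6.1 h6.2⟩, h7⟩
  · rintro ⟨⟨y1, y2, z1, z2, z3, z4⟩, h⟩ ⟨⟨y1', y2', z1', z2', z3', z4'⟩, h'⟩ heq
    simp only [Subtype.mk.injEq, Prod.mk.injEq, Nat.cast_inj] at heq ⊢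
    tauto
end
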